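/- Let k ≥ 3, 1 ≤ a ≤ k−1, m ≥ 1 and λ = mω_a. Let V^λ be an irreducible highest weight U_q(sl_k)-module with highest weight vector v_λ, crystal lattice L^λ, crystal basis B^λ ⊂ L^λ/qL^λ, and lower global basis G^λ = {G_b}_{b ∈ B^λ}. For 0 ≤ j ≤ m set v_j := f_{k−1}^{(j)} ⋯ f_a^{(j)} v_λ, and let V̂^{λ^j} be an irreducible highest weight U_q(sl_{k−1})-module with highest weight λ^j := j ω′_{a−1} + (m−j) ω′_a and highest weight vector u_j, with crystal lattice L̂^{λ^j}, crystal basis B̂^{λ^j}, and lower global basis Ĝ^{λ^j} = {Ĝ^j_b}_{b ∈ B̂^{λ^j}}; let φ_j : V̂^{λ^j} → U_q(sl_{k−1})v_j ⊆ V^λ be the U_q(sl_{k−1})-module isomorphism with φ_j(u_j) = v_j. Then: (1) L^λ = ⊕_{j=0}^m φ_j(L̂^{λ^j}); (2) B^λ is the disjoint union over j = 0, …, m of the images of B̂^{λ^j} under the maps L̂^{λ^j}/qL̂^{λ^j} → L^λ/qL^λ induced by φ_j; and (3) G^λ = ⊔_{j=0}^m φ_j(Ĝ^{λ^j}), and in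 particular φ_j(Ĝ^j_b) = G_{φ_j(b)} for all b ∈ B̂^{λ^j}. -/

import Mathlib

/-!
Common setup: the quantum group `U_q(sl_k)` (presented by generators
`e_i, f_i, K_i = q^{h_i}, K_i⁻¹` for `1 ≤ i ≤ k-1` and the standard relations)
over the field `KK = ℚ(q)`, and the notion of an irreducible highest weight
module.  Weights are recorded as functions `μ : ℕ → ℤ`, `μ i` being the value
`μ(h_i)` on the `i`-th simple coroot.
-/

noncomputable section
namespace QSL

abbrev KK : Type := RatFunc ℚ

/-- the variable `q`. -/
def qv : KK := RatFunc.X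

/-- the quantum integer `[n]_q = (qⁿ - q⁻ⁿ)/(q - q⁻¹)`. -/
def qInt (n : ℕ) : KK := (qv ^ n - qv⁻¹ ^ n) / (qv - qv⁻¹)

/-- the quantum factorial `[n]_q!`. -/
def qFact : ℕ → KK
  | 0 => 1
  | n + 1 => qFact n * qInt (n + 1)

/-- the Gaussian binomial coefficient `[m choose j]_q`. -/
def qBinom (m j : ℕ) : KK :=
  (∏ t ∈ Finset.range j, qInt (m - t)) / (∏ t ∈ Finset.range j, qInt (j - t))

/-- the Cartan matrix of `sl`:  `cartan i j = αⱼ(h_i)`. -/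
def cartan (i j : ℕ) : ℤ := if i = j then 2 else if i + 1 = j ∨ j + 1 = i then -1 else 0

/-- The quantum group with `d` nodes (`d = k - 1` for `U_q(sl_k)`): a unital
associative `ℚ(q)`-algebra generated by elements `e i, f i, K i, Kinv i`
(`1 ≤ i ≤ d`, where `K i = q^{h_i}`) subject to the standard relations. -/
structure QGroup (d : ℕ) where
  U : Type
  [ring : Ring U]
  [alg : Algebra KK U]
  e : ℕ → U
  f : ℕ → U
  K : ℕ → U
  Kinv : ℕ → U
  K_mul_Kinv : ∀ i, 1 ≤ i → i ≤ d → K i * Kinv i = 1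
  Kinv_mul_K : ∀ i, 1 ≤ i → i ≤ d → Kinv i * K i = 1
  K_comm : ∀ i j, 1 ≤ i → i ≤ d → 1 ≤ j → j ≤ d → K i * K j = K j * K i
  K_e_Kinv : ∀ i j, 1 ≤ i → i ≤ d → 1 ≤ j → j ≤ d →
      K i * e j * Kinv i = (qv ^ cartan i j) • e j
  K_f_Kinv : ∀ i j, 1 ≤ i → i ≤ d → 1 ≤ j → j ≤ d →
      K i * f j * Kinv i = (qv ^ (-cartan i j)) • f j
  e_f_comm : ∀ i j, 1 ≤ i → i ≤ d → 1 ≤ j → j ≤ d →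
      e i * f j - f j * e i = if i = j then (qv - qv⁻¹)⁻¹ • (K i - Kinv i) else 0
  serre_e : ∀ i j, 1 ≤ i → i ≤ d → 1 ≤ j → j ≤ d → (i + 1 = j ∨ j + 1 = i) →
      e i * e i * e j - (qv + qv⁻¹) • (e i * e j * e i) + e j * e i * e i = 0
  serre_f : ∀ i j, 1 ≤ i → i ≤ d → 1 ≤ j → j ≤ d → (i + 1 = j ∨ j + 1 = i) →
      f i * f i * f j - (qv + qv⁻¹) • (f i * f j * f i) + f j * f i * f i = 0
  comm_e : ∀ i j, 1 ≤ i → i ≤ d → 1 ≤ j → j ≤ d → (i + 1 < j ∨ j + 1 < i) →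
      e i * e j = e j * e i
  comm_f : ∀ i j, 1 ≤ i → i ≤ d → 1 ≤ j → j ≤ d → (i + 1 < j ∨ j + 1 < i) →
      f i * f j = f j * f i
  gen : ∀ x : U, x ∈ Algebra.adjoin KK
      {y : U | ∃ i, 1 ≤ i ∧ i ≤ d ∧ (y = e i ∨ y = f i ∨ y = K i ∨ y = Kinv i)}

attribute [instance] QGroup.ring QGroup.alg

variable {d : ℕ} (G : QGroup d)

/-- the divided power `f_i^{(n)} = f_iⁿ/[n]_q!`. -/
def fDiv (i n : ℕ) : G.U := (qFact n)⁻¹ • (G.f i) ^ n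

/-- the divided power `e_i^{(n)} = e_iⁿ/[n]_q!`. -/
def eDiv (i n : ℕ) : G.U := (qFact n)⁻¹ • (G.e i) ^ n

variable {V : Type} [AddCommGroup V] [Module KK V] [Module G.U V] [IsScalarTower KK G.U V]

/-- `u` is a weight vector of weight `μ` (recorded via `μ i = μ(h_i)`). -/
def IsWtVec (u : V) (μ : ℕ → ℤ) : Prop :=
  ∀ i, 1 ≤ i → i ≤ d → G.K i • u = (qv ^ μ i) • u

/-- `V` is an irreducible highest weight module over `G` with highest weight
`lam` and highest weight vector `v`: it is finite dimensional over `ℚ(q)`,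
has a weight space decomposition, `v` is a nonzero weight vector of weight
`lam` annihilated by the `e_i`, `V` is generated by `v`, and `V` is
irreducible. -/
structure IsHWModule (lam : ℕ → ℤ) (v : V) : Prop where
  findim : FiniteDimensional KK V
  ne_zero : v ≠ 0
  wt : IsWtVec G v lam
  hw : ∀ i, 1 ≤ i → i ≤ d → G.e i • v = 0
  gen : ∀ w : V, ∃ p : G.U, p • v = w
  irred : ∀ W : Submodule G.U V, W = ⊥ ∨ W = ⊤
  decomp : Submodule.span KK {u : V | ∃ μ : ℕ → ℤ, IsWtVec G u μ} = ⊤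

/-- the weight `m ω_a`. -/
def omWt (a m : ℕ) : ℕ → ℤ := fun i => if i = a then (m : ℤ) else 0

/-- the weight `j ω_{a-1} + (m - j) ω_a`. -/
def hookWt (a m j : ℕ) : ℕ → ℤ := fun i =>
  (if i = a - 1 then (j : ℤ) else 0) + (if i = a then (m : ℤ) - (j : ℤ) else 0)

/-- `f_{a'}^{(c_{a'})} ⋯ f_{a+1}^{(c_{a+1})} f_a^{(c_a)} • v`. -/
def fDivChain (c : ℕ → ℕ) (a a' : ℕ) (v : V) : V :=
  (List.range (a' + 1 - a)).foldl (fun u r => fDiv G (a + r) (c (a + r)) • u) v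

/-- An `i`-string decomposition of the weight vector `u`: a triple
`p = (N, u_·, μ)` where `u` has weight `μ`, each `u_n` lies in `ker e_i`, is a
weight vector of weight `μ + n αᵢ`, and `u = ∑_{n=0}^{N} f_i^{(n)} • u_n`. -/
def KashDecomp (i : ℕ) (u : V) (p : ℕ × (ℕ → V) × (ℕ → ℤ)) : Prop :=
  IsWtVec G u p.2.2 ∧
  (∀ n, n ≤ p.1 → G.e i • p.2.1 n = 0 ∧
      IsWtVec G (p.2.1 n) fun t => p.2.2 t + n * cartan i t) ∧
  u = ∑ n ∈ Finset.range (p.1 + 1), fDiv G i n • p.2.1 n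

open Classical in
/-- The Kashiwara lowering operator `f̃ᵢ`: on a weight vector with string
decomposition `u = ∑ f_i^{(n)} u_n` it returns `∑ f_i^{(n+1)} u_n`. -/
noncomputable def kashF (i : ℕ) (u : V) : V :=
  if h : ∃ p : ℕ × (ℕ → V) × (ℕ → ℤ), KashDecomp G i u p then
    ∑ n ∈ Finset.range (h.choose.1 + 1), fDiv G i (n + 1) • h.choose.2.1 n
  else 0

/-- `f̃_{i_r} ⋯ f̃_{i_1} u` for `is = [i_1, …, i_r]`. -/
noncomputable def kashSeq (is : List ℕ) (u : V) : V :=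
  is.foldl (fun w i => kashF G i w) u

private lemma eval_ne_zero_of_dvd {a b : Polynomial ℚ} (h : a ∣ b) (hb : b.eval 0 ≠ 0) :
    a.eval 0 ≠ 0 := by
  obtain ⟨c, rfl⟩ := h
  simp only [Polynomial.eval_mul, ne_eq, mul_eq_zero, not_or] at hb
  exact hb.1

/-- `A₀`: the subring of `ℚ(q)` of rational functions regular at `q = 0`,
i.e. the localization of `ℚ[q]` at the prime ideal `(q)`. -/
def A0 : Subring KK where
  carrier := {x : KK | (RatFunc.denom x).eval 0 ≠ 0}
  one_mem' := by simp [RatFunc.denom_one]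
  zero_mem' := by simp [RatFunc.denom_zero]
  mul_mem' := by
    intro x y hx hy
    refine eval_ne_zero_of_dvd (RatFunc.denom_mul_dvd x y) ?_
    simpa [Polynomial.eval_mul] using mul_ne_zero hx hy
  add_mem' := by
    intro x y hx hy
    refine eval_ne_zero_of_dvd (RatFunc.denom_add_dvd x y) ?_
    simpa [Polynomial.eval_mul] using mul_ne_zero hx hy
  neg_mem' := by
    intro x hx
    have hneg : (-x) = (-1 : KK) * x := by ring
    rw [hneg]
    refine eval_ne_zero_of_dvd (RatFunc.denom_mul_dvd (-1) x) ?_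
    have h1 : (RatFunc.denom (-1 : KK)) = 1 := by
      have : (-1 : KK) = algebraMap (Polynomial ℚ) KK (-1) := by simp
      rw [this, RatFunc.denom_algebraMap]
    simpa [Polynomial.eval_mul, h1] using hx

/-- Multiplication by `q` as an `A₀`-linear endomorphism. -/
def qSmulMap : V →ₗ[↥A0] V where
  toFun x := qv • x
  map_add' x y := smul_add qv x y
  map_smul' c x := by
    show qv • ((c : KK) • x) = ((c : KK) • qv • x : V)
    rw [smul_smul, smul_smul, mul_comm]

/-- a `ℚ(q)`-linear map, viewed as an `A₀`-linear map. -/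
def toA0Linear {W : Type} [AddCommGroup W] [Module KK W] (f : V →ₗ[KK] W) : V →ₗ[↥A0] W where
  toFun := f
  map_add' := f.map_add
  map_smul' c x := by
    show f ((c : KK) • x) = (c : KK) • f x
    rw [map_smul]

/-- the vectors `f̃_{i_r} ⋯ f̃_{i_1} v`. -/
noncomputable def latticeGens (v : V) : Set V :=
  {u | ∃ is : List ℕ, (∀ i ∈ is, 1 ≤ i ∧ i ≤ d) ∧ u = kashSeq G is v}

/-- the crystal lattice `L`: the `A₀`-span of the `f̃_{i_r} ⋯ f̃_{i_1} v`. -/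
noncomputable def Llat (v : V) : Submodule ↥A0 V :=
  Submodule.span ↥A0 (latticeGens G v)

/-- the `A₀`-submodule `qL ⊆ L`. -/
noncomputable def qLmod (v : V) : Submodule ↥A0 V :=
  Submodule.map qSmulMap (Llat G v)

/-- the generators `e_i, f_i, K_i, K_i⁻¹` with `1 ≤ i ≤ b`. -/
def subGens (b : ℕ) : Set G.U :=
  {y | ∃ i, 1 ≤ i ∧ i ≤ b ∧ (y = G.e i ∨ y = G.f i ∨ y = G.K i ∨ y = G.Kinv i)}

/-- the subalgebra `U_q(sl_{b+1}) ⊆ U_q(sl_{d+1})` generated by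
`e_i, f_i, q^{±h_i}` for `1 ≤ i ≤ b`. -/
def Usub (b : ℕ) : Subalgebra KK G.U := Algebra.adjoin KK (subGens G b)

/-- the subspace `U_q(sl_{b+1}) • x ⊆ V`. -/
def USpan (b : ℕ) (x : V) : Submodule KK V :=
  Submodule.span KK {w : V | ∃ p ∈ Usub G b, w = p • x}

/-- the subring `A = ℚ[q, q⁻¹] ⊆ ℚ(q)`. -/
def Asub : Subring KK := Subring.closure ({qv, qv⁻¹} ∪ Set.range (algebraMap ℚ KK))

/-- `q^{z h_i}` as an element of `G.U`. -/
def zKpow (i : ℕ) (z : ℤ) : G.U := if 0 ≤ z then G.K i ^ z.toNat else G.Kinv i ^ (-z).toNat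

/-- `q^h` for `h = ∑ c_i h_i` in the coroot lattice. -/
def KmonZ (c : ℕ → ℤ) : G.U := ((List.range d).map fun t => zKpow G (t + 1) (c (t + 1))).prod

/-- the element `[q^h; s]_q = (q^h q^s - q^{-h} q^{-s})/(q - q⁻¹)`. -/
def qhBr (c : ℕ → ℤ) (s : ℤ) : G.U :=
  (qv - qv⁻¹)⁻¹ • ((qv ^ s) • KmonZ G c - (qv ^ (-s)) • KmonZ G (fun t => -c t))

/-- the element `[q^h; 0]_q [q^h; -1]_q ⋯ [q^h; 1-n]_q / [n]_q!`. -/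
def qhDiv (c : ℕ → ℤ) (n : ℕ) : G.U :=
  (qFact n)⁻¹ • ((List.range n).map fun s => qhBr G c (-(s : ℤ))).prod

/-- the `A`-subalgebra `U_A ⊆ U_q` generated by the divided powers
`e_i^{(n)}, f_i^{(n)}`, the `q^h`, and the `[q^h; 0]_q ⋯ [q^h; 1-n]_q/[n]_q!`. -/
def UAring : Subring G.U :=
  Subring.closure
    ({x | ∃ y ∈ Asub, x = algebraMap KK G.U y} ∪
     {x | ∃ i n, 1 ≤ i ∧ i ≤ d ∧ (x = eDiv G i n ∨ x = fDiv G i n)} ∪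
     {x | ∃ c : ℕ → ℤ, x = KmonZ G c ∨ ∃ n, x = qhDiv G c n})

/-- the subset `U_A • v ⊆ V`. -/
def UAv (v : V) : Set V := {x : V | ∃ p ∈ UAring G, x = p • v}

/-- `barK` is the `ℚ`-algebra automorphism of `ℚ(q)` with `q ↦ q⁻¹`. -/
def IsBarK (barK : KK →+* KK) : Prop :=
  barK qv = qv⁻¹ ∧ ∀ r : ℚ, barK (algebraMap ℚ KK r) = algebraMap ℚ KK r

/-- `psi` is the `ψ`-involution of `(V, v)`: the `barK`-semilinear additive
involution with `ψ(v) = v`, `ψ(e_i x) = e_i ψ(x)`, `ψ(f_i x) = f_i ψ(x)` and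
`ψ(q^h x) = q^{-h} ψ(x)`.  (These properties determine it uniquely.) -/
def IsPsi (v : V) (barK : KK →+* KK) (psi : V →+ V) : Prop :=
  psi v = v ∧
  (∀ (c : KK) (x : V), psi (c • x) = barK c • psi x) ∧
  (∀ i, 1 ≤ i → i ≤ d → ∀ x : V, psi (G.e i • x) = G.e i • psi x) ∧
  (∀ i, 1 ≤ i → i ≤ d → ∀ x : V, psi (G.f i • x) = G.f i • psi x) ∧
  (∀ i, 1 ≤ i → i ≤ d → ∀ x : V, psi (G.K i • x) = G.Kinv i • psi x) ∧
  (∀ i, 1 ≤ i → i ≤ d → ∀ x : V, psi (G.Kinv i • x) = G.K i • psi x)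

variable [Module ℚ V] [IsScalarTower ℚ KK V]

/-- `Gs` is the lower global basis of `(V, v)`: the unique `A₀`-basis of the
crystal lattice `L` which is a `ℚ`-basis of `U_A v ∩ L ∩ ψ(L)`, is fixed by
`ψ`, and reduces modulo `qL` bijectively onto the crystal basis `B`. -/
noncomputable def IsLowerGlobalBasis (v : V) (psi : V →+ V) (Gs : Set V) : Prop :=
  Submodule.span ↥A0 Gs = Llat G v ∧
  LinearIndependent ↥A0 (fun g : Gs => (g : V)) ∧
  Gs ⊆ UAv G v ∩ (Llat G v : Set V) ∩ (psi '' (Llat G v : Set V)) ∧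
  LinearIndependent ℚ (fun g : Gs => (g : V)) ∧
  (∀ x, x ∈ UAv G v ∩ (Llat G v : Set V) ∩ (psi '' (Llat G v : Set V)) →
    x ∈ Submodule.span ℚ Gs) ∧
  (∀ g ∈ Gs, psi g = g) ∧
  (∀ g ∈ Gs, ∃ u ∈ latticeGens G v, u ∉ qLmod G v ∧ g - u ∈ qLmod G v) ∧
  (∀ g ∈ Gs, ∀ g' ∈ Gs, g - g' ∈ qLmod G v → g = g') ∧
  (∀ u ∈ latticeGens G v, u ∉ qLmod G v → ∃ g ∈ Gs, g - u ∈ qLmod G v)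

/-! ### Quantum integers -/

lemma qv_ne_zero : qv ≠ 0 := RatFunc.X_ne_zero

lemma qv_pow_ne_one {n : ℕ} (hn : n ≠ 0) : qv ^ n ≠ 1 := by
  intro h
  have h1 : algebraMap (Polynomial ℚ) KK (Polynomial.X ^ n) = algebraMap (Polynomial ℚ) KK 1 := by
    simpa [qv, RatFunc.algebraMap_X] using h
  have h2 := congrArg Polynomial.natDegree (RatFunc.algebraMap_injective ℚ h1)
  simp at h2
  exact hn h2

lemma qv_zpow_eq_one {z : ℤ} (h : qv ^ z = 1) : z = 0 := by
  by_contra hz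
  obtain ⟨n, rfl | rfl⟩ := z.eq_nat_or_neg
  · exact qv_pow_ne_one (n := n) (by omega) (by simpa using h)
  · exact qv_pow_ne_one (n := n) (by omega) (by simpa using h)

lemma qv_zpow_injective : Function.Injective fun z : ℤ => qv ^ z := by
  intro a b h
  have h1 : qv ^ (a - b) = 1 := by
    rw [zpow_sub₀ qv_ne_zero]
    exact (div_eq_one_iff_eq (zpow_ne_zero _ qv_ne_zero)).2 h
  have := qv_zpow_eq_one h1
  omega

lemma qv_sub_inv_ne_zero : qv - qv⁻¹ ≠ 0 := by
  intro h
  have h1 : qv ^ (1 : ℤ) = qv ^ (-1 : ℤ) := by simpa [sub_eq_zero] using h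
  have := qv_zpow_injective h1
  omega

/-- The quantum integer `[z]_q` for an arbitrary integer `z`. -/
def qz (z : ℤ) : KK := (qv ^ z - qv ^ (-z)) / (qv - qv⁻¹)

lemma qz_ne_zero {z : ℤ} (hz : z ≠ 0) : qz z ≠ 0 := by
  refine div_ne_zero ?_ qv_sub_inv_ne_zero
  intro h
  have := qv_zpow_injective (sub_eq_zero.1 h)
  omega

@[simp] lemma qz_zero : qz 0 = 0 := by simp [qz]

lemma qInt_eq_qz (n : ℕ) : qInt n = qz n := by
  simp [qInt, qz]

lemma qz_one : qz 1 = 1 := by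
  simpa [qz] using div_self qv_sub_inv_ne_zero

lemma qFact_ne_zero (n : ℕ) : qFact n ≠ 0 := by
  induction n with
  | zero => simp [qFact]
  | succ n ih =>
    rw [qFact, qInt_eq_qz]
    exact mul_ne_zero ih (qz_ne_zero (by omega))

lemma qz_mul_two (l : ℤ) : qz l * (qv + qv⁻¹) - qz (l - 1) = qz (l + 1) := by
  have h0 := qv_ne_zero
  simp only [qz, neg_sub, neg_add, zpow_add₀ h0, zpow_sub₀ h0, zpow_neg, zpow_one]
  have h1 : qv ^ l ≠ 0 := zpow_ne_zero _ h0
  rw [div_mul_eq_mul_div, div_sub_div_same]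
  congr 1
  field_simp
  ring

/-- the identity behind `e f^{n+1} = f^{n+1} e + [n+1] f^n [h - n]`. -/
lemma qz_step (c n : ℤ) :
    qz (n + 1) * qz (c - n) + qz (c - 2 * (n + 1)) = qz (n + 2) * qz (c - (n + 1)) := by
  have h0 := qv_ne_zero
  have hs := qv_sub_inv_ne_zero
  have hc : qv ^ c ≠ 0 := zpow_ne_zero _ h0
  have hn : qv ^ n ≠ 0 := zpow_ne_zero _ h0
  have h2 : (qv : KK) ^ (2 : ℤ) = qv * qv := by rw [zpow_two]
  have hnn : qv ^ (2 * n) = qv ^ n * qv ^ n := by rw [two_mul, zpow_add₀ h0]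
  simp only [qz, neg_sub, neg_add, zpow_add₀ h0, zpow_sub₀ h0, zpow_neg, zpow_one, mul_add, mul_one,
    h2, hnn]
  have h4 : (qv - qv⁻¹) * qv = qv * qv - 1 := by
    rw [sub_mul, inv_mul_cancel₀ h0]
  have h5 : qv - qv⁻¹ = (qv * qv - 1) / qv := by
    rw [← h4, mul_div_assoc, div_self h0, mul_one]
  have h6 : qv * qv - 1 ≠ 0 := by
    rw [← h4]; exact mul_ne_zero hs h0
  rw [h5]
  generalize qv ^ c = x at *
  generalize qv ^ n = y at *
  generalize qv = z at *
  have h7 : z ^ 2 - 1 ≠ 0 := by rwa [pow_two]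
  field_simp
  ring

/-! ### Finite dimensional representations of quantum `sl_2` -/

section SlTwo

variable {W : Type} [AddCommGroup W] [Module KK W]

/-- `E`, `F` and `K` act on weight vectors of `W` as the generators of `U_q(sl_2)`. -/
structure IsSlTwo (E F K : W →ₗ[KK] W) : Prop where
  wtE : ∀ (c : ℤ) (x : W), K x = qv ^ c • x → K (E x) = qv ^ (c + 2) • E x
  wtF : ∀ (c : ℤ) (x : W), K x = qv ^ c • x → K (F x) = qv ^ (c - 2) • F x
  comm : ∀ (c : ℤ) (x : W), K x = qv ^ c • x → E (F x) = F (E x) + qz c • x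

lemma exists_eq_zero_of_weights [FiniteDimensional KK W] (K : W →ₗ[KK] W) (x : ℕ → W) (w : ℕ → ℤ)
    (hw : Function.Injective w) (hx : ∀ n, K (x n) = qv ^ w n • x n) : ∃ n, x n = 0 := by
  by_contra! h
  have hli : LinearIndependent KK x :=
    Module.End.eigenvectors_linearIndependent' K (fun n => qv ^ w n)
      (fun a b hab => hw (qv_zpow_injective hab)) x
      (fun n => ⟨Module.End.mem_eigenspace_iff.2 (hx n), h n⟩)
  exact not_finite_iff_infinite.2 inferInstance hli.finite

namespace IsSlTwo

variable {E F K : W →ₗ[KK] W} (h : IsSlTwo E F K)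
include h

lemma wt_pow_F (n : ℕ) {c : ℤ} {x : W} (hx : K x = qv ^ c • x) :
    K ((F ^ n) x) = qv ^ (c - 2 * n) • (F ^ n) x := by
  induction n with
  | zero => simpa using hx
  | succ n ih =>
    rw [pow_succ', Module.End.mul_apply, h.wtF _ _ ih]
    congr 2
    push_cast
    ring

lemma wt_pow_E (n : ℕ) {c : ℤ} {x : W} (hx : K x = qv ^ c • x) :
    K ((E ^ n) x) = qv ^ (c + 2 * n) • (E ^ n) x := by
  induction n with
  | zero => simpa using hx
  | succ n ih =>
    rw [pow_succ', Module.End.mul_apply, h.wtE _ _ ih]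
    congr 2
    push_cast
    ring

lemma E_pow_F (n : ℕ) {c : ℤ} {x : W} (hx : K x = qv ^ c • x) :
    E ((F ^ (n + 1)) x) = (F ^ (n + 1)) (E x) + (qz (n + 1) * qz (c - n)) • (F ^ n) x := by
  induction n with
  | zero => simpa [qz_one] using h.comm c x hx
  | succ n ih =>
    have hp (k : ℕ) (y : W) : (F ^ (k + 1)) y = F ((F ^ k) y) := by
      rw [pow_succ', Module.End.mul_apply]
    rw [hp (n + 1), h.comm _ _ (h.wt_pow_F (n + 1) hx), ih, map_add, map_smul, ← hp, ← hp,
      add_assoc, ← add_smul]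
    have := qz_step c n
    push_cast
    rw [this]
    congr 4

lemma exists_pow_F_eq_zero [FiniteDimensional KK W] {c : ℤ} {x : W} (hx : K x = qv ^ c • x) :
    ∃ n, (F ^ n) x = 0 :=
  exists_eq_zero_of_weights K _ _ (fun a b hab => by simp at hab; omega)
    (fun n => h.wt_pow_F n hx)

lemma exists_pow_E_eq_zero [FiniteDimensional KK W] {c : ℤ} {x : W} (hx : K x = qv ^ c • x) :
    ∃ n, (E ^ n) x = 0 :=
  exists_eq_zero_of_weights K _ _ (fun a b hab => by simp at hab; omega)
    (fun n => h.wt_pow_E n hx)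

lemma eq_zero_of_neg [FiniteDimensional KK W] {c : ℤ} {x : W} (hx : K x = qv ^ c • x)
    (hc : c < 0) (hFE : F (E x) = 0) : x = 0 := by
  obtain ⟨n, hn⟩ := h.exists_pow_F_eq_zero hx
  induction n with
  | zero => simpa using hn
  | succ n ih =>
    apply ih
    have h1 := h.E_pow_F n hx
    rw [hn, map_zero, pow_succ, Module.End.mul_apply, hFE, map_zero, zero_add] at h1
    exact (smul_eq_zero.1 h1.symm).resolve_left
      (mul_ne_zero (qz_ne_zero (by omega)) (qz_ne_zero (by omega)))

lemma pow_F_eq_zero [FiniteDimensional KK W] {c : ℤ} {x : W} (hx : K x = qv ^ c • x)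
    (hE : E x = 0) {n : ℕ} (hn : c < n) : (F ^ n) x = 0 := by
  rcases lt_or_ge c 0 with hc | hc
  · rw [h.eq_zero_of_neg hx hc (by simp [hE]), map_zero]
  · obtain ⟨l, rfl⟩ := Int.eq_ofNat_of_zero_le hc
    obtain ⟨r, rfl⟩ : ∃ r, n = r + (l + 1) := ⟨n - (l + 1), by omega⟩
    have h1 : (F ^ (l + 1)) x = 0 := by
      refine h.eq_zero_of_neg (h.wt_pow_F (l + 1) hx) (by push_cast; omega) ?_
      rw [h.E_pow_F l hx]
      simp [hE]
    rw [pow_add, Module.End.mul_apply, h1, map_zero]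

lemma sum_pow_F_eq_zero [FiniteDimensional KK W] (N : ℕ) : ∀ (c : ℤ) (u : ℕ → W),
    (∀ n < N, E (u n) = 0) → (∀ n < N, K (u n) = qv ^ (c + 2 * n) • u n) →
    ∑ n ∈ Finset.range N, (F ^ n) (u n) = 0 → ∀ n < N, (F ^ n) (u n) = 0 := by
  induction N with
  | zero => intro c u _ _ _ n hn; omega
  | succ N ih =>
    intro c u hE hK hs
    have h1 : ∀ n < N, (F ^ (n + 1)) (u (n + 1)) = 0 := by
      have hd : ∑ n ∈ Finset.range N, (F ^ n) ((qz (n + 1) * qz (c + n + 2)) • u (n + 1)) = 0 := by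
        have h2 := congrArg E hs
        rw [Finset.sum_range_succ', map_add, map_sum, map_zero] at h2
        rw [pow_zero, Module.End.one_apply, hE 0 (by omega), add_zero] at h2
        rw [← h2]
        refine Finset.sum_congr rfl fun n hn => ?_
        have hn' : n + 1 < N + 1 := by simpa using hn
        rw [h.E_pow_F n (hK (n + 1) hn'), hE _ hn', map_zero, zero_add, map_smul]
        congr 3
        push_cast
        ring
      have h3 := ih (c + 2) (fun n => (qz (n + 1) * qz (c + n + 2)) • u (n + 1))
        (fun n hn => by simp [hE (n + 1) (by omega)])
        (fun n hn => by
          simp only [map_smul]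
          rw [hK (n + 1) (by omega), smul_comm]
          have : c + 2 * ((n + 1 : ℕ) : ℤ) = c + 2 + 2 * n := by push_cast; ring
          rw [this]) hd
      intro n hn
      by_cases hz : c + n + 2 = 0
      · exact h.pow_F_eq_zero (hK (n + 1) (by omega)) (hE _ (by omega)) (by push_cast; omega)
      · have h4 := h3 n hn
        rw [map_smul] at h4
        have h5 := (smul_eq_zero.1 h4).resolve_left
          (mul_ne_zero (qz_ne_zero (by omega)) (qz_ne_zero hz))
        rw [pow_succ', Module.End.mul_apply, h5, map_zero]
    have h0 : (F ^ 0) (u 0) = 0 := by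
      rw [Finset.sum_range_succ', Finset.sum_eq_zero, zero_add] at hs
      · exact hs
      · intro n hn
        exact h1 n (by simpa using hn)
    intro n hn
    cases n with
    | zero => exact h0
    | succ n => exact h1 n (by omega)

end IsSlTwo
end SlTwo

lemma IsSlTwo.exists_string_decomp {W : Type} [AddCommGroup W] [Module KK W]
    [FiniteDimensional KK W] {E F K : W →ₗ[KK] W} (h : IsSlTwo E F K) (P : ℤ → Submodule KK W)
    (c : ℤ) (hP : ∀ n, ∀ x ∈ P n, K x = qv ^ (c + 2 * n) • x)
    (hE : ∀ n, ∀ x ∈ P n, E x ∈ P (n + 1)) (hF : ∀ n, ∀ x ∈ P n, F x ∈ P (n - 1)) (N : ℕ) :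
    ∀ (n : ℤ), ∀ x ∈ P n, (E ^ N) x = 0 →
      ∃ u : ℕ → W, (∀ t : ℕ, u t ∈ P (n + t) ∧ E (u t) = 0) ∧
        x = ∑ t ∈ Finset.range N, (F ^ t) (u t) := by
  have hFp : ∀ (t : ℕ) (n : ℤ), ∀ x ∈ P n, (F ^ t) x ∈ P (n - t) := by
    intro t
    induction t with
    | zero => intro n x hx; simpa using hx
    | succ t ih =>
      intro n x hx
      rw [pow_succ', Module.End.mul_apply]
      have := hF _ _ (ih n x hx)
      rwa [show n - (t + 1 : ℕ) = n - t - 1 by push_cast; ring]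
  induction N with
  | zero =>
    intro n x _ hx
    exact ⟨0, fun t => ⟨Submodule.zero_mem _, by simp⟩, by simpa using hx⟩
  | succ N ih =>
    intro n x hxP hx
    obtain ⟨u, hu, hsum⟩ := ih (n + 1) (E x) (hE n x hxP)
      (by rwa [pow_succ, Module.End.mul_apply] at hx)
    let γ : ℕ → KK := fun t => qz (t + 1) * qz (c + 2 * n + 2 + t)
    have huK : ∀ t, K (u t) = qv ^ (c + 2 * n + 2 + 2 * t) • u t := by
      intro t
      rw [hP _ _ (hu t).1]
      congr 2
      ring
    have hEF : ∀ t, E ((F ^ (t + 1)) (u t)) = γ t • (F ^ t) (u t) := by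
      intro t
      rw [h.E_pow_F t (huK t), (hu t).2, map_zero, zero_add]
      congr 3
      ring
    set y := x - ∑ t ∈ Finset.range N, (γ t)⁻¹ • (F ^ (t + 1)) (u t) with hy
    have hyP : y ∈ P n := by
      refine Submodule.sub_mem _ hxP (Submodule.sum_mem _ fun t _ => Submodule.smul_mem _ _ ?_)
      have := hFp (t + 1) _ _ (hu t).1
      rwa [show n + 1 + t - (t + 1 : ℕ) = n by push_cast; ring] at this
    have hEy : E y = ∑ t ∈ Finset.range N, (1 - (γ t)⁻¹ * γ t) • (F ^ t) (u t) := by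
      rw [hy, map_sub, hsum, map_sum, ← Finset.sum_sub_distrib]
      refine Finset.sum_congr rfl fun t _ => ?_
      rw [map_smul, hEF, smul_smul, sub_smul, one_smul]
    have hγ : ∀ t : ℕ, c + 2 * n + 2 + t ≠ 0 → (γ t)⁻¹ * γ t = 1 := fun t ht =>
      inv_mul_cancel₀ (mul_ne_zero (qz_ne_zero (by omega)) (qz_ne_zero ht))
    have hEy0 : E y = 0 := by
      rcases lt_or_ge (c + 2 * n) 0 with hneg | hpos
      · rw [h.eq_zero_of_neg (hP n y hyP) hneg, map_zero]
        rw [hEy, map_sum]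
        refine Finset.sum_eq_zero fun t _ => ?_
        rw [map_smul]
        by_cases ht : c + 2 * n + 2 + t = 0
        · rw [← Module.End.mul_apply, ← pow_succ',
            h.pow_F_eq_zero (huK t) (hu t).2 (by push_cast; omega), smul_zero]
        · rw [hγ t ht, sub_self, zero_smul]
      · rw [hEy]
        refine Finset.sum_eq_zero fun t _ => ?_
        rw [hγ t (by omega), sub_self, zero_smul]
    refine ⟨fun t => Nat.casesOn t y fun t => (γ t)⁻¹ • u t, ?_, ?_⟩
    · rintro (_ | t)
      · exact ⟨by simpa using hyP, hEy0⟩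
      · refine ⟨Submodule.smul_mem _ _ ?_, by simp [(hu t).2]⟩
        have := (hu t).1
        rwa [show n + (t + 1 : ℕ) = n + 1 + t by push_cast; ring]
    · rw [Finset.sum_range_succ']
      simp [hy]

/-! ### Weight vectors and string decompositions -/

lemma cartan_symm (i j : ℕ) : cartan i j = cartan j i := by
  unfold cartan
  split_ifs <;> first | rfl | omega

section Highest

variable {W : Type} [AddCommGroup W] [Module KK W] [Module G.U W] [IsScalarTower KK G.U W]

/-- The action of an element of the quantum group, as a `ℚ(q)`-linear map. -/
def act (W : Type) [AddCommGroup W] [Module KK W] [Module G.U W] [IsScalarTower KK G.U W]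
    (x : G.U) : W →ₗ[KK] W where
  toFun w := x • w
  map_add' := smul_add x
  map_smul' c w := by
    rw [RingHom.id_apply, ← algebraMap_smul G.U c w, smul_smul, ← Algebra.commutes, ← smul_smul,
      algebraMap_smul]

omit [IsScalarTower KK G.U W] in
variable {G} in
lemma IsWtVec.congr {x : W} {μ ν : ℕ → ℤ} (h : IsWtVec G x μ)
    (hμ : ∀ i, 1 ≤ i → i ≤ d → μ i = ν i) : IsWtVec G x ν := by
  intro i h1 h2
  rw [← hμ i h1 h2]
  exact h i h1 h2

@[simp] lemma act_apply (x : G.U) (w : W) : act G W x w = x • w := rfl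

lemma smul_smul_comm' (x : G.U) (c : KK) (w : W) : x • c • w = c • x • w :=
  (act G W x).map_smul c w

lemma act_pow (x : G.U) (n : ℕ) (w : W) : (act G W x ^ n) w = x ^ n • w := by
  induction n with
  | zero => simp
  | succ n ih => rw [pow_succ', Module.End.mul_apply, ih, act_apply, smul_smul, ← pow_succ']

lemma fDiv_smul (i n : ℕ) (w : W) : fDiv G i n • w = (qFact n)⁻¹ • (G.f i ^ n • w) := by
  rw [fDiv, smul_assoc]

lemma K_smul_of_conj {i : ℕ} (h1 : 1 ≤ i) (h2 : i ≤ d) {y : G.U} {z : ℤ}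
    (hy : G.K i * y * G.Kinv i = qv ^ z • y) {w : W} {c : ℤ} (hw : G.K i • w = qv ^ c • w) :
    G.K i • y • w = qv ^ (c + z) • y • w := by
  have h3 : G.K i * y = qv ^ z • (y * G.K i) := by
    rw [← smul_mul_assoc, ← hy, mul_assoc, G.Kinv_mul_K i h1 h2, mul_one]
  rw [smul_smul, h3, smul_assoc, mul_smul, hw, smul_smul_comm', smul_smul, ← zpow_add₀ qv_ne_zero,
    add_comm]

lemma Kinv_smul {i : ℕ} (h1 : 1 ≤ i) (h2 : i ≤ d) {w : W} {c : ℤ} (hw : G.K i • w = qv ^ c • w) :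
    G.Kinv i • w = qv ^ (-c) • w := by
  have : w = qv ^ c • G.Kinv i • w := by
    rw [← smul_smul_comm', ← hw, smul_smul, G.Kinv_mul_K i h1 h2, one_smul]
  conv_rhs => rw [this]
  rw [smul_smul, ← zpow_add₀ qv_ne_zero, neg_add_cancel, zpow_zero, one_smul]

lemma e_smul_f_smul {i j : ℕ} (hi : 1 ≤ i) (hi' : i ≤ d) (hj : 1 ≤ j) (hj' : j ≤ d) {w : W} {c : ℤ}
    (hw : G.K i • w = qv ^ c • w) :
    G.e i • G.f j • w = G.f j • G.e i • w + if i = j then qz c • w else 0 := by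
  have h1 : (G.e i * G.f j - G.f j * G.e i) • w = if i = j then qz c • w else 0 := by
    rw [G.e_f_comm i j hi hi' hj hj']
    split_ifs with h
    · rw [smul_assoc, sub_smul, hw, Kinv_smul G hi hi' hw, ← sub_smul, smul_smul, qz, div_eq_inv_mul]
    · exact zero_smul _ _
  rw [← h1, sub_smul, smul_smul, smul_smul]
  abel

lemma isSlTwo_act {i : ℕ} (h1 : 1 ≤ i) (h2 : i ≤ d) :
    IsSlTwo (act G W (G.e i)) (act G W (G.f i)) (act G W (G.K i)) where
  wtE c x hx := by
    have := K_smul_of_conj G h1 h2 (G.K_e_Kinv i i h1 h2 h1 h2) hx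
    simpa [cartan] using this
  wtF c x hx := by
    have := K_smul_of_conj G h1 h2 (G.K_f_Kinv i i h1 h2 h1 h2) hx
    simpa [cartan, sub_eq_add_neg] using this
  comm c x hx := by
    have := e_smul_f_smul G h1 h2 h1 h2 hx
    simpa using this

/-- If two string decompositions have the same sum then applying `f_i^{(n)} ↦ f_i^{(n+1)}` to them
gives the same result. -/
lemma sum_fDiv_succ_eq [FiniteDimensional KK W] {i : ℕ} (h1 : 1 ≤ i) (h2 : i ≤ d) (c : ℤ)
    (N : ℕ) (u : ℕ → W) (hE : ∀ n < N, G.e i • u n = 0)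
    (hK : ∀ n < N, G.K i • u n = qv ^ (c + 2 * n) • u n)
    (hs : ∑ n ∈ Finset.range N, fDiv G i n • u n = 0) :
    ∑ n ∈ Finset.range N, fDiv G i (n + 1) • u n = 0 := by
  have h := (isSlTwo_act (W := W) G h1 h2).sum_pow_F_eq_zero N c (fun n => (qFact n)⁻¹ • u n)
    (fun n hn => by simp [hE n hn]) (fun n hn => by simp [hK n hn, smul_comm (qFact n)⁻¹])
    (by simpa [act_pow, fDiv_smul, smul_smul_comm'] using hs)
  refine Finset.sum_eq_zero fun n hn => ?_
  have h3 := h n (by simpa using hn)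
  rw [map_smul, act_pow] at h3
  have h4 := (smul_eq_zero.1 h3).resolve_left (inv_ne_zero (qFact_ne_zero n))
  rw [fDiv_smul, pow_succ', mul_smul, h4, smul_zero, smul_zero]

omit [Module KK W] [IsScalarTower KK G.U W] in
lemma sum_range_extend (g : ℕ → G.U) (N M : ℕ) (h : N ≤ M) (u : ℕ → W) :
    ∑ n ∈ Finset.range M, g n • (if n < N then u n else 0) = ∑ n ∈ Finset.range N, g n • u n := by
  rw [← Finset.sum_subset (Finset.range_subset_range.2 h)]
  · exact Finset.sum_congr rfl fun n hn => by rw [if_pos (by simpa using hn)]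
  · intro n _ hn
    rw [if_neg (by simpa using hn), smul_zero]

/-- `f̃ᵢ` can be computed from any string decomposition. -/
lemma kashF_eq [FiniteDimensional KK W] {i : ℕ} (h1 : 1 ≤ i) (h2 : i ≤ d) {x : W}
    (hex : ∃ p : ℕ × (ℕ → W) × (ℕ → ℤ), KashDecomp G i x p) (c : ℤ)
    (hx : G.K i • x = qv ^ c • x) (N : ℕ) (u : ℕ → W) (hE : ∀ n < N, G.e i • u n = 0)
    (hK : ∀ n < N, G.K i • u n = qv ^ (c + 2 * n) • u n)
    (hs : x = ∑ n ∈ Finset.range N, fDiv G i n • u n) :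
    kashF G i x = ∑ n ∈ Finset.range N, fDiv G i (n + 1) • u n := by
  rw [kashF, dif_pos hex]
  obtain ⟨hw, hu, hsum⟩ := hex.choose_spec
  set p := hex.choose
  by_cases hx0 : x = 0
  · subst hx0
    rw [sum_fDiv_succ_eq G h1 h2 c N u hE hK hs.symm]
    refine sum_fDiv_succ_eq G h1 h2 (p.2.2 i) (p.1 + 1) p.2.1 (fun n hn => (hu n (by omega)).1)
      (fun n hn => ?_) hsum.symm
    rw [(hu n (by omega)).2 i h1 h2]
    simp [cartan, mul_comm]
  · have hc : p.2.2 i = c := by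
      have h3 := hw i h1 h2
      rw [hx] at h3
      exact (qv_zpow_injective (smul_left_injective KK hx0 h3)).symm
    have hM1 := le_max_left (p.1 + 1) N
    have hM2 := le_max_right (p.1 + 1) N
    set M := max (p.1 + 1) N
    rw [← sub_eq_zero, ← sum_range_extend G (fun n => fDiv G i (n + 1)) (p.1 + 1) M hM1 p.2.1,
      ← sum_range_extend G (fun n => fDiv G i (n + 1)) N M hM2 u, ← Finset.sum_sub_distrib]
    simp only [← smul_sub]
    refine sum_fDiv_succ_eq G h1 h2 c M _ ?_ ?_ ?_
    · intro n _
      rw [smul_sub]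
      rw [sub_eq_zero]
      trans (0 : W)
      · split_ifs with h3
        · exact (hu n (by omega)).1
        · exact smul_zero _
      · split_ifs with h3
        · exact (hE n h3).symm
        · exact (smul_zero _).symm
    · intro n _
      have h5 : ∀ n < p.1 + 1, G.K i • p.2.1 n = qv ^ (c + 2 * n) • p.2.1 n := by
        intro n hn
        rw [(hu n (by omega)).2 i h1 h2, ← hc]
        simp [cartan, mul_comm]
      rw [smul_sub, smul_sub]
      congr 1
      · split_ifs with h3
        · exact h5 n h3
        · simp
      · split_ifs with h3
        · exact hK n h3
        · simp
    · simp only [smul_sub]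
      rw [Finset.sum_sub_distrib, sum_range_extend G (fun n => fDiv G i n) (p.1 + 1) M hM1,
        sum_range_extend G (fun n => fDiv G i n) N M hM2, ← hsum, ← hs, sub_self]

end Highest

/-! ### The spaces spanned by monomials in the `f_i` of fixed content -/

section Content

variable {W : Type} [AddCommGroup W] [Module KK W] [Module G.U W] [IsScalarTower KK G.U W]

/-- `FMon G v c x`: the vector `x` is a monomial in the `f_i` applied to `v`, in which `f_i` occurs
`c i` times. -/
inductive FMon (v : W) : (ℕ → ℤ) → W → Prop
  | base : FMon v 0 v
  | step {c : ℕ → ℤ} {x : W} (i : ℕ) : 1 ≤ i → i ≤ d → FMon v c x →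
      FMon v (c + Pi.single i 1) (G.f i • x)

/-- `KMon G v c x`: the vector `x` is a monomial in the `f̃_i` applied to `v`, in which `f̃_i`
occurs `c i` times. -/
inductive KMon (v : W) : (ℕ → ℤ) → W → Prop
  | base : KMon v 0 v
  | step {c : ℕ → ℤ} {x : W} (i : ℕ) : 1 ≤ i → i ≤ d → KMon v c x →
      KMon v (c + Pi.single i 1) (kashF G i x)

/-- The span of the monomials in the `f_i` of content `c`. -/
def fSpace (v : W) (c : ℕ → ℤ) : Submodule KK W := Submodule.span KK {x | FMon G v c x}

/-- The weight `λ - ∑ c_t α_t`. -/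
def wtSub (d : ℕ) (lam c : ℕ → ℤ) : ℕ → ℤ :=
  fun i => lam i - ∑ t ∈ Finset.Icc 1 d, c t * cartan i t

lemma wtSub_add_single (lam c : ℕ → ℤ) {i : ℕ} (h1 : 1 ≤ i) (h2 : i ≤ d) (z : ℤ) (j : ℕ) :
    wtSub d lam (c + z • Pi.single i 1) j = wtSub d lam c j - z * cartan j i := by
  have : ∑ t ∈ Finset.Icc 1 d, (z • Pi.single i 1 : ℕ → ℤ) t * cartan j t = z * cartan j i := by
    rw [Finset.sum_eq_single i]
    · simp
    · intro t _ ht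
      simp [Pi.single_eq_of_ne ht]
    · intro h
      exact absurd (Finset.mem_Icc.2 ⟨h1, h2⟩) h
  simp only [wtSub, Pi.add_apply, add_mul, Finset.sum_add_distrib, this]
  ring

variable {v : W} {lam : ℕ → ℤ}

lemma FMon.isWtVec (hv : IsWtVec G v lam) {c : ℕ → ℤ} {x : W} (hx : FMon G v c x) :
    IsWtVec G x (wtSub d lam c) := by
  induction hx with
  | base => exact hv.congr fun i _ _ => by simp [wtSub]
  | @step c x i h1 h2 _ ih =>
    intro j hj1 hj2
    rw [K_smul_of_conj G hj1 hj2 (G.K_f_Kinv j i hj1 hj2 h1 h2) (ih j hj1 hj2)]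
    have := wtSub_add_single lam c h1 h2 1 j
    rw [one_smul] at this
    rw [this, one_mul, sub_eq_add_neg]

lemma isWtVec_of_mem_fSpace (hv : IsWtVec G v lam) {c : ℕ → ℤ} {x : W} (hx : x ∈ fSpace G v c) :
    IsWtVec G x (wtSub d lam c) := by
  intro j hj1 hj2
  induction hx using Submodule.span_induction with
  | mem x hx => exact hx.isWtVec G hv j hj1 hj2
  | zero => simp
  | add x y _ _ hx hy => rw [smul_add, smul_add, hx, hy]
  | smul a x _ hx => rw [smul_smul_comm', hx, smul_comm]

lemma f_smul_mem_fSpace {i : ℕ} (h1 : 1 ≤ i) (h2 : i ≤ d) {c : ℕ → ℤ} {x : W}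
    (hx : x ∈ fSpace G v c) : G.f i • x ∈ fSpace G v (c + Pi.single i 1) := by
  induction hx using Submodule.span_induction with
  | mem x hx => exact Submodule.subset_span (FMon.step i h1 h2 hx)
  | zero => simp
  | add x y _ _ hx hy => rw [smul_add]; exact add_mem hx hy
  | smul a x _ hx => rw [smul_smul_comm']; exact Submodule.smul_mem _ _ hx

lemma e_smul_mem_fSpace (hv : IsWtVec G v lam) (hw : ∀ i, 1 ≤ i → i ≤ d → G.e i • v = 0)
    {i : ℕ} (h1 : 1 ≤ i) (h2 : i ≤ d) {c : ℕ → ℤ} {x : W}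
    (hx : x ∈ fSpace G v c) : G.e i • x ∈ fSpace G v (c - Pi.single i 1) := by
  induction hx using Submodule.span_induction with
  | mem x hx =>
    induction hx with
    | base => rw [hw i h1 h2]; exact zero_mem _
    | @step c x j hj1 hj2 hx ih =>
      rw [e_smul_f_smul G h1 h2 hj1 hj2 (hx.isWtVec G hv i h1 h2)]
      refine add_mem ?_ ?_
      · have := f_smul_mem_fSpace G hj1 hj2 ih
        rwa [show c + Pi.single j 1 - Pi.single i 1 = c - Pi.single i 1 + Pi.single j 1 by abel]
      · split_ifs with hij
        · subst hij
          rw [add_sub_cancel_right]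
          exact Submodule.smul_mem _ _ (Submodule.subset_span hx)
        · exact zero_mem _
  | zero => simp
  | add x y _ _ hx hy => rw [smul_add]; exact add_mem hx hy
  | smul a x _ hx => rw [smul_smul_comm']; exact Submodule.smul_mem _ _ hx

/-- The monomials in the `f_i` applied to the highest weight vector span the module. -/
lemma span_FMon_eq_top (hv : IsWtVec G v lam) (hw : ∀ i, 1 ≤ i → i ≤ d → G.e i • v = 0)
    (hgen : ∀ w : W, ∃ p : G.U, p • v = w) :
    Submodule.span KK {x : W | ∃ c, FMon G v c x} = ⊤ := by
  set S := Submodule.span KK {x : W | ∃ c, FMon G v c x} with hS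
  have hle : ∀ c, fSpace G v c ≤ S := fun c => Submodule.span_mono fun x hx => ⟨c, hx⟩
  have key : ∀ y : G.U, (∀ c x, FMon G v c x → y • x ∈ S) → ∀ x ∈ S, y • x ∈ S := by
    intro y hy x hx
    induction hx using Submodule.span_induction with
    | mem x hx => exact hy _ _ hx.choose_spec
    | zero => simp
    | add x y _ _ hx hy => rw [smul_add]; exact add_mem hx hy
    | smul a x _ hx => rw [smul_smul_comm']; exact Submodule.smul_mem _ _ hx
  have stable : ∀ p : G.U, ∀ x ∈ S, p • x ∈ S := by
    intro p
    induction G.gen p using Algebra.adjoin_induction with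
    | mem y hy =>
      obtain ⟨i, h1, h2, rfl | rfl | rfl | rfl⟩ := hy
      · exact key _ fun c x hx =>
          hle _ (e_smul_mem_fSpace G hv hw h1 h2 (Submodule.subset_span hx))
      · exact key _ fun c x hx => hle _ (f_smul_mem_fSpace G h1 h2 (Submodule.subset_span hx))
      · refine key _ fun c x hx => ?_
        rw [hx.isWtVec G hv i h1 h2]
        exact S.smul_mem _ (Submodule.subset_span ⟨c, hx⟩)
      · refine key _ fun c x hx => ?_
        rw [Kinv_smul G h1 h2 (hx.isWtVec G hv i h1 h2)]
        exact S.smul_mem _ (Submodule.subset_span ⟨c, hx⟩)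
    | algebraMap r => intro x hx; rw [algebraMap_smul]; exact S.smul_mem _ hx
    | add p q _ _ hp hq => intro x hx; rw [add_smul]; exact add_mem (hp x hx) (hq x hx)
    | mul p q _ _ hp hq => intro x hx; rw [mul_smul]; exact hp _ (hq x hx)
  refine eq_top_iff.2 fun w _ => ?_
  obtain ⟨p, rfl⟩ := hgen w
  exact stable p v (Submodule.subset_span ⟨0, FMon.base⟩)

lemma isWtVec_of_mem_fSpace_sub (hv : IsWtVec G v lam) {i : ℕ} (h1 : 1 ≤ i) (h2 : i ≤ d)
    {c : ℕ → ℤ} {n : ℤ} {x : W} (hx : x ∈ fSpace G v (c - n • Pi.single i 1)) :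
    IsWtVec G x fun t => wtSub d lam c t + n * cartan i t := by
  refine (isWtVec_of_mem_fSpace G hv hx).congr fun j _ _ => ?_
  rw [sub_eq_add_neg, ← neg_smul, wtSub_add_single lam c h1 h2, cartan_symm i j]
  ring

lemma K_smul_of_mem_fSpace_sub (hv : IsWtVec G v lam) {i : ℕ} (h1 : 1 ≤ i) (h2 : i ≤ d)
    {c : ℕ → ℤ} {n : ℤ} {x : W} (hx : x ∈ fSpace G v (c - n • Pi.single i 1)) :
    G.K i • x = qv ^ (wtSub d lam c i + 2 * n) • x := by
  rw [isWtVec_of_mem_fSpace_sub G hv h1 h2 hx i h1 h2]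
  simp [cartan, mul_comm]

lemma exists_decomp_of_mem_fSpace [FiniteDimensional KK W] (hv : IsWtVec G v lam)
    (hw : ∀ i, 1 ≤ i → i ≤ d → G.e i • v = 0) {i : ℕ} (h1 : 1 ≤ i) (h2 : i ≤ d) {c : ℕ → ℤ} {x : W}
    (hx : x ∈ fSpace G v c) : ∃ (N : ℕ) (u : ℕ → W),
      (∀ n : ℕ, u n ∈ fSpace G v (c - (n : ℤ) • Pi.single i 1) ∧ G.e i • u n = 0) ∧
      x = ∑ n ∈ Finset.range (N + 1), fDiv G i n • u n := by
  have hsl := isSlTwo_act (W := W) G h1 h2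
  obtain ⟨N, hN⟩ := hsl.exists_pow_E_eq_zero (isWtVec_of_mem_fSpace G hv hx i h1 h2)
  have hN' : (act G W (G.e i) ^ (N + 1)) x = 0 := by
    rw [pow_succ', Module.End.mul_apply, hN, map_zero]
  have hE : ∀ n : ℤ, ∀ x ∈ fSpace G v (c - n • Pi.single i 1),
      act G W (G.e i) x ∈ fSpace G v (c - (n + 1) • Pi.single i 1) := by
    intro n x hx
    have := e_smul_mem_fSpace G hv hw h1 h2 hx
    rwa [show c - (n + 1) • Pi.single i 1 = c - n • Pi.single i 1 - Pi.single i 1 by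
      rw [add_smul, one_smul]; abel]
  have hF : ∀ n : ℤ, ∀ x ∈ fSpace G v (c - n • Pi.single i 1),
      act G W (G.f i) x ∈ fSpace G v (c - (n - 1) • Pi.single i 1) := by
    intro n x hx
    have := f_smul_mem_fSpace G h1 h2 hx
    rwa [show c - (n - 1) • Pi.single i 1 = c - n • Pi.single i 1 + Pi.single i 1 by
      rw [sub_smul, one_smul]; abel]
  obtain ⟨u, hu, hs⟩ := hsl.exists_string_decomp
    (fun n => fSpace G v (c - n • Pi.single i 1)) (wtSub d lam c i)
    (fun n x hx => K_smul_of_mem_fSpace_sub G hv h1 h2 hx) hE hF (N + 1) 0 x (by simpa using hx) hN'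
  refine ⟨N, fun n => qFact n • u n, fun n => ⟨?_, ?_⟩, ?_⟩
  · have := (hu n).1
    rw [zero_add] at this
    exact Submodule.smul_mem _ _ this
  · have := (hu n).2
    rw [act_apply] at this
    rw [smul_smul_comm', this, smul_zero]
  · rw [hs]
    refine Finset.sum_congr rfl fun n _ => ?_
    rw [fDiv_smul, smul_smul_comm', smul_smul, inv_mul_cancel₀ (qFact_ne_zero n), one_smul,
      act_pow]

lemma exists_kashDecomp [FiniteDimensional KK W] (hv : IsWtVec G v lam)
    (hw : ∀ i, 1 ≤ i → i ≤ d → G.e i • v = 0) {i : ℕ} (h1 : 1 ≤ i) (h2 : i ≤ d) {c : ℕ → ℤ} {x : W}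
    (hx : x ∈ fSpace G v c) : ∃ p : ℕ × (ℕ → W) × (ℕ → ℤ), KashDecomp G i x p := by
  obtain ⟨N, u, hu, hs⟩ := exists_decomp_of_mem_fSpace G hv hw h1 h2 hx
  exact ⟨(N, u, wtSub d lam c), isWtVec_of_mem_fSpace G hv hx,
    fun n _ => ⟨(hu n).2, isWtVec_of_mem_fSpace_sub G hv h1 h2 (hu n).1⟩, hs⟩

lemma pow_f_smul_mem_fSpace {i : ℕ} (h1 : 1 ≤ i) (h2 : i ≤ d) {c : ℕ → ℤ} {x : W}
    (hx : x ∈ fSpace G v c) (n : ℕ) :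
    fDiv G i n • x ∈ fSpace G v (c + (n : ℤ) • Pi.single i 1) := by
  rw [fDiv_smul]
  refine Submodule.smul_mem _ _ ?_
  induction n with
  | zero => simpa using hx
  | succ n ih =>
    have := f_smul_mem_fSpace G h1 h2 ih
    rw [pow_succ', mul_smul]
    rwa [show c + ((n + 1 : ℕ) : ℤ) • Pi.single i 1 = c + (n : ℤ) • Pi.single i 1 + Pi.single i 1 by
      push_cast; rw [add_smul, one_smul]; abel]

lemma kashF_eq_of_mem [FiniteDimensional KK W] (hv : IsWtVec G v lam)
    (hw : ∀ i, 1 ≤ i → i ≤ d → G.e i • v = 0) {i : ℕ} (h1 : 1 ≤ i) (h2 : i ≤ d) {c : ℕ → ℤ} {x : W}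
    (hx : x ∈ fSpace G v c) (N : ℕ) (u : ℕ → W)
    (hu : ∀ n : ℕ, u n ∈ fSpace G v (c - (n : ℤ) • Pi.single i 1) ∧ G.e i • u n = 0)
    (hs : x = ∑ n ∈ Finset.range N, fDiv G i n • u n) :
    kashF G i x = ∑ n ∈ Finset.range N, fDiv G i (n + 1) • u n :=
  kashF_eq G h1 h2 (exists_kashDecomp G hv hw h1 h2 hx) (wtSub d lam c i)
    (isWtVec_of_mem_fSpace G hv hx i h1 h2) N u (fun n _ => (hu n).2)
    (fun n _ => K_smul_of_mem_fSpace_sub G hv h1 h2 (hu n).1) hs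

lemma kashF_mem_fSpace [FiniteDimensional KK W] (hv : IsWtVec G v lam)
    (hw : ∀ i, 1 ≤ i → i ≤ d → G.e i • v = 0) {i : ℕ} (h1 : 1 ≤ i) (h2 : i ≤ d) {c : ℕ → ℤ} {x : W}
    (hx : x ∈ fSpace G v c) : kashF G i x ∈ fSpace G v (c + Pi.single i 1) := by
  obtain ⟨N, u, hu, hs⟩ := exists_decomp_of_mem_fSpace G hv hw h1 h2 hx
  rw [kashF_eq_of_mem G hv hw h1 h2 hx (N + 1) u hu hs]
  refine Submodule.sum_mem _ fun n _ => ?_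
  have := pow_f_smul_mem_fSpace G h1 h2 (hu n).1 (n + 1)
  rwa [show c - (n : ℤ) • Pi.single i 1 + ((n + 1 : ℕ) : ℤ) • Pi.single i 1 = c + Pi.single i 1 by
    push_cast; rw [add_smul, one_smul]; abel] at this

lemma kashF_add [FiniteDimensional KK W] (hv : IsWtVec G v lam)
    (hw : ∀ i, 1 ≤ i → i ≤ d → G.e i • v = 0) {i : ℕ} (h1 : 1 ≤ i) (h2 : i ≤ d) {c : ℕ → ℤ}
    {x y : W} (hx : x ∈ fSpace G v c) (hy : y ∈ fSpace G v c) :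
    kashF G i (x + y) = kashF G i x + kashF G i y := by
  obtain ⟨N, u, hu, hs⟩ := exists_decomp_of_mem_fSpace G hv hw h1 h2 hx
  obtain ⟨M, t, ht, hs'⟩ := exists_decomp_of_mem_fSpace G hv hw h1 h2 hy
  have hL1 := le_max_left (N + 1) (M + 1)
  have hL2 := le_max_right (N + 1) (M + 1)
  set L := max (N + 1) (M + 1)
  rw [kashF_eq_of_mem G hv hw h1 h2 hx (N + 1) u hu hs,
    kashF_eq_of_mem G hv hw h1 h2 hy (M + 1) t ht hs',
    kashF_eq_of_mem G hv hw h1 h2 (add_mem hx hy) L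
      (fun n => (if n < N + 1 then u n else 0) + if n < M + 1 then t n else 0),
    ← sum_range_extend G (fun n => fDiv G i (n + 1)) (N + 1) L hL1 u,
    ← sum_range_extend G (fun n => fDiv G i (n + 1)) (M + 1) L hL2 t, ← Finset.sum_add_distrib]
  · simp only [smul_add]
  · intro n
    refine ⟨add_mem ?_ ?_, ?_⟩
    · split_ifs
      exacts [(hu n).1, zero_mem _]
    · split_ifs
      exacts [(ht n).1, zero_mem _]
    · rw [smul_add]
      split_ifs <;> simp [(hu n).2, (ht n).2]
  · simp only [smul_add]
    rw [Finset.sum_add_distrib, sum_range_extend G (fun n => fDiv G i n) (N + 1) L hL1,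
      sum_range_extend G (fun n => fDiv G i n) (M + 1) L hL2, ← hs, ← hs']

lemma kashF_smul [FiniteDimensional KK W] (hv : IsWtVec G v lam)
    (hw : ∀ i, 1 ≤ i → i ≤ d → G.e i • v = 0) {i : ℕ} (h1 : 1 ≤ i) (h2 : i ≤ d) {c : ℕ → ℤ}
    {x : W} (hx : x ∈ fSpace G v c) (a : KK) :
    kashF G i (a • x) = a • kashF G i x := by
  obtain ⟨N, u, hu, hs⟩ := exists_decomp_of_mem_fSpace G hv hw h1 h2 hx
  rw [kashF_eq_of_mem G hv hw h1 h2 hx (N + 1) u hu hs,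
    kashF_eq_of_mem G hv hw h1 h2 (Submodule.smul_mem _ a hx) (N + 1) (fun n => a • u n),
    Finset.smul_sum]
  · exact Finset.sum_congr rfl fun n _ => smul_smul_comm' _ _ _ _
  · exact fun n => ⟨Submodule.smul_mem _ _ (hu n).1, by rw [smul_smul_comm', (hu n).2, smul_zero]⟩
  · conv_lhs => rw [hs]
    rw [Finset.smul_sum]
    exact Finset.sum_congr rfl fun n _ => (smul_smul_comm' _ _ _ _).symm

lemma KMon.mem_fSpace [FiniteDimensional KK W] (hv : IsWtVec G v lam)
    (hw : ∀ i, 1 ≤ i → i ≤ d → G.e i • v = 0) {c : ℕ → ℤ} {x : W} (hx : KMon G v c x) :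
    x ∈ fSpace G v c := by
  induction hx with
  | base => exact Submodule.subset_span FMon.base
  | step i h1 h2 _ ih => exact kashF_mem_fSpace G hv hw h1 h2 ih

/-- `f_i • x` is the image under `f̃_i` of a vector of the same content as `x`. -/
lemma exists_kashF_eq_f_smul [FiniteDimensional KK W] (hv : IsWtVec G v lam)
    (hw : ∀ i, 1 ≤ i → i ≤ d → G.e i • v = 0) {i : ℕ} (h1 : 1 ≤ i) (h2 : i ≤ d) {c : ℕ → ℤ} {x : W}
    (hx : x ∈ fSpace G v c) : ∃ y ∈ fSpace G v c, kashF G i y = G.f i • x := by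
  obtain ⟨N, u, hu, hs⟩ := exists_decomp_of_mem_fSpace G hv hw h1 h2 hx
  have hy : ∑ n ∈ Finset.range (N + 1), fDiv G i n • qInt (n + 1) • u n ∈ fSpace G v c := by
    refine Submodule.sum_mem _ fun n _ => ?_
    have := pow_f_smul_mem_fSpace G h1 h2 (Submodule.smul_mem _ (qInt (n + 1)) (hu n).1) n
    rwa [sub_add_cancel] at this
  refine ⟨_, hy, ?_⟩
  rw [kashF_eq_of_mem G hv hw h1 h2 hy (N + 1) (fun n => qInt (n + 1) • u n) ?_ rfl, hs,
    Finset.smul_sum]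
  · refine Finset.sum_congr rfl fun n _ => ?_
    have h3 : qInt (n + 1) ≠ 0 := by
      rw [qInt_eq_qz]
      exact qz_ne_zero (by omega)
    rw [fDiv_smul, fDiv_smul, smul_smul_comm', smul_smul, smul_smul_comm', smul_smul, ← pow_succ',
      qFact, mul_inv, mul_assoc, inv_mul_cancel₀ h3, mul_one]
  · exact fun n => ⟨Submodule.smul_mem _ _ (hu n).1, by rw [smul_smul_comm', (hu n).2, smul_zero]⟩

omit [Module KK W] [IsScalarTower KK G.U W] in
lemma FMon.sum_nonneg {c : ℕ → ℤ} {x : W} (hx : FMon G v c x) :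
    0 ≤ ∑ t ∈ Finset.Icc 1 d, c t := by
  induction hx with
  | base => simp
  | @step c x i h1 h2 _ ih =>
    have : ∑ t ∈ Finset.Icc 1 d, (Pi.single i 1 : ℕ → ℤ) t = 1 := by
      rw [Finset.sum_pi_single' i 1]
      exact if_pos (Finset.mem_Icc.2 ⟨h1, h2⟩)
    simp only [Pi.add_apply, Finset.sum_add_distrib, this]
    omega

lemma fSpace_le_span_KMon [FiniteDimensional KK W] (hv : IsWtVec G v lam)
    (hw : ∀ i, 1 ≤ i → i ≤ d → G.e i • v = 0) (n : ℕ) : ∀ c : ℕ → ℤ,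
    ∑ t ∈ Finset.Icc 1 d, c t < n → fSpace G v c ≤ Submodule.span KK {x | KMon G v c x} := by
  induction n with
  | zero =>
    intro c hc
    refine Submodule.span_le.2 fun x hx => ?_
    have := FMon.sum_nonneg G hx
    omega
  | succ n ih =>
    intro c hc
    refine Submodule.span_le.2 fun x hx => ?_
    cases hx with
    | base => exact Submodule.subset_span KMon.base
    | @step c x i h1 h2 hx =>
      obtain ⟨y, hy, hyx⟩ := exists_kashF_eq_f_smul G hv hw h1 h2 (Submodule.subset_span hx)
      rw [SetLike.mem_coe, ← hyx]
      have hs : ∑ t ∈ Finset.Icc 1 d, (Pi.single i 1 : ℕ → ℤ) t = 1 := by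
        rw [Finset.sum_pi_single' i 1]
        exact if_pos (Finset.mem_Icc.2 ⟨h1, h2⟩)
      simp only [Pi.add_apply, Finset.sum_add_distrib, hs] at hc
      have hy' := ih c (by push_cast at hc; omega) hy
      have h4 : ∀ y ∈ Submodule.span KK {x | KMon G v c x}, y ∈ fSpace G v c ∧
          kashF G i y ∈ Submodule.span KK {x | KMon G v (c + Pi.single i 1) x} := by
        intro y hy
        induction hy using Submodule.span_induction with
        | mem y hy =>
          exact ⟨hy.mem_fSpace G hv hw, Submodule.subset_span (KMon.step i h1 h2 hy)⟩
        | zero =>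
          refine ⟨zero_mem _, ?_⟩
          have := kashF_smul G hv hw h1 h2 (zero_mem (fSpace G v c)) 0
          rw [smul_zero, zero_smul] at this
          rw [this]
          exact zero_mem _
        | add y z _ _ hy hz =>
          refine ⟨add_mem hy.1 hz.1, ?_⟩
          rw [kashF_add G hv hw h1 h2 hy.1 hz.1]
          exact add_mem hy.2 hz.2
        | smul a y _ hy =>
          refine ⟨Submodule.smul_mem _ _ hy.1, ?_⟩
          rw [kashF_smul G hv hw h1 h2 hy.1]
          exact Submodule.smul_mem _ _ hy.2
      exact (h4 y hy').2

omit [IsScalarTower KK G.U W] in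
lemma kashF_mem_latticeGens {i : ℕ} (h1 : 1 ≤ i) (h2 : i ≤ d) {x : W}
    (hx : x ∈ latticeGens G v) : kashF G i x ∈ latticeGens G v := by
  obtain ⟨is, his, rfl⟩ := hx
  refine ⟨is ++ [i], fun j hj => ?_, by simp [kashSeq]⟩
  rcases List.mem_append.1 hj with hj | hj
  · exact his j hj
  · rw [List.mem_singleton.1 hj]
    exact ⟨h1, h2⟩

omit [IsScalarTower KK G.U W] in
lemma self_mem_latticeGens : v ∈ latticeGens G v := ⟨[], by simp, rfl⟩

omit [IsScalarTower KK G.U W] in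
lemma KMon.mem_latticeGens {c : ℕ → ℤ} {x : W} (hx : KMon G v c x) : x ∈ latticeGens G v := by
  induction hx with
  | base => exact self_mem_latticeGens G
  | step i h1 h2 _ ih => exact kashF_mem_latticeGens G h1 h2 ih

omit [IsScalarTower KK G.U W] in
lemma exists_KMon {x : W} (hx : x ∈ latticeGens G v) : ∃ c, KMon G v c x := by
  obtain ⟨is, his, rfl⟩ := hx
  induction is using List.reverseRecOn with
  | nil => exact ⟨0, KMon.base⟩
  | append_singleton is i ih =>
    obtain ⟨c, hc⟩ := ih fun j hj => his j (List.mem_append_left _ hj)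
    obtain ⟨h1, h2⟩ := his i (by simp)
    refine ⟨c + Pi.single i 1, ?_⟩
    have := hc.step i h1 h2
    simpa [kashSeq] using this

/-- The vectors `f̃_{i_r} ⋯ f̃_{i_1} v` span the module. -/
lemma span_latticeGens_eq_top (hV : IsHWModule G lam v) :
    Submodule.span KK (latticeGens G v) = ⊤ := by
  have := hV.findim
  rw [eq_top_iff, ← span_FMon_eq_top G hV.wt hV.hw hV.gen]
  refine Submodule.span_le.2 ?_
  rintro x ⟨c, hx⟩
  have h1 := fSpace_le_span_KMon G hV.wt hV.hw (∑ t ∈ Finset.Icc 1 d, c t + 1).toNat c (by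
    have := hx.sum_nonneg G
    omega) (Submodule.subset_span hx)
  exact Submodule.span_mono (fun y hy => KMon.mem_latticeGens G hy) h1

end Content

/-! ### Consequences of the Serre relations -/

section Serre

variable {A : Type} [Ring A] [Algebra KK A] {a b : A}

lemma serre_pow_mul (h : b * b * a - (qv + qv⁻¹) • (b * a * b) + a * b * b = 0) (l : ℕ) :
    b ^ (l + 1) * a = qz (l + 1) • (b * a * b ^ l) - qz l • (a * b ^ (l + 1)) := by
  induction l with
  | zero => simp [qz_one]
  | succ l ih =>
    have h1 : b * b * a = (qv + qv⁻¹) • (b * a * b) - a * b * b := by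
      rw [eq_sub_iff_add_eq, ← sub_eq_zero, ← h]
      abel
    have h2 := qz_mul_two (l + 1)
    have h3 : b * (b * a * b ^ l) = (qv + qv⁻¹) • (b * a * b ^ (l + 1)) - a * b ^ (l + 1 + 1) := by
      rw [← mul_assoc, ← mul_assoc, h1, sub_mul, smul_mul_assoc, pow_succ' b (l + 1),
        pow_succ' b l]
      simp only [mul_assoc]
    rw [add_sub_cancel_right] at h2
    rw [pow_succ', mul_assoc, ih, mul_sub, mul_smul_comm, mul_smul_comm, h3]
    push_cast
    rw [← h2, ← mul_assoc b a, ← pow_succ', smul_sub, sub_smul, smul_smul]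
    abel

lemma serre_mul_pow (h : a * a * b - (qv + qv⁻¹) • (a * b * a) + b * a * a = 0) (l : ℕ) :
    b * a ^ (l + 1) = qz (l + 1) • (a ^ l * b * a) - qz l • (a ^ (l + 1) * b) := by
  induction l with
  | zero => simp [qz_one]
  | succ l ih =>
    have h1 : b * a * a = (qv + qv⁻¹) • (a * b * a) - a * a * b := by
      rw [eq_sub_iff_add_eq, ← sub_eq_zero, ← h]
      abel
    have h2 := qz_mul_two (l + 1)
    have h3 : a ^ l * b * a * a = (qv + qv⁻¹) • (a ^ (l + 1) * b * a) - a ^ (l + 1 + 1) * b := by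
      rw [mul_assoc, mul_assoc, ← mul_assoc b, h1, mul_sub, mul_smul_comm, pow_succ a (l + 1),
        pow_succ a l]
      simp only [mul_assoc]
    rw [add_sub_cancel_right] at h2
    rw [pow_succ a (l + 1), ← mul_assoc, ih, sub_mul, smul_mul_assoc, smul_mul_assoc, h3]
    push_cast
    rw [← h2, pow_succ a (l + 1)]
    simp only [mul_assoc, smul_sub, sub_smul, smul_smul]
    abel

variable {W : Type} [AddCommGroup W] [Module KK W] [Module A W] [IsScalarTower KK A W]

/-- If `b z = 0` then `bʲ aⁱ z` is a multiple of `a^{i-j} bʲ aʲ z`. -/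
lemma exists_pow_smul_pow_smul_eq
    (hab : a * a * b - (qv + qv⁻¹) • (a * b * a) + b * a * a = 0)
    (hba : b * b * a - (qv + qv⁻¹) • (b * a * b) + a * b * b = 0) (j : ℕ) :
    ∀ (i : ℕ) (z : W), b • z = 0 → ∃ c : KK,
      b ^ j • a ^ i • z = c • (a ^ (i - j) • b ^ j • a ^ j • z) := by
  have hsm : ∀ (x : A) (c : KK) (w : W), x • c • w = c • x • w := by
    intro x c w
    rw [← algebraMap_smul A c w, smul_smul, ← Algebra.commutes, ← smul_smul, algebraMap_smul]
  induction j with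
  | zero => exact fun i z _ => ⟨1, by simp⟩
  | succ j ih =>
    intro i z hz
    have h1 : ∀ l : ℕ, b • a ^ (l + 1) • z = qz (l + 1) • a ^ l • b • a • z := by
      intro l
      rw [smul_smul, serre_mul_pow hab, sub_smul, smul_assoc, smul_assoc, mul_smul, mul_smul,
        mul_smul, hz, smul_zero, smul_zero, sub_zero]
    have h2 : b • b • a • z = 0 := by
      have := congrArg (· • z) hba
      simpa [add_smul, sub_smul, mul_smul, hz] using this
    have h3 : b ^ j • a ^ j • b • a • z = (qz (j + 1))⁻¹ • (b ^ (j + 1) • a ^ (j + 1) • z) := by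
      rw [pow_succ b j, mul_smul, h1, hsm, smul_smul (qz _)⁻¹, inv_mul_cancel₀ (qz_ne_zero (by omega)),
        one_smul]
    cases i with
    | zero => exact ⟨0, by rw [pow_zero, one_smul, pow_succ, mul_smul, hz, smul_zero, zero_smul]⟩
    | succ i =>
      obtain ⟨c, hc⟩ := ih i (b • a • z) h2
      refine ⟨qz (i + 1) * c * (qz (j + 1))⁻¹, ?_⟩
      rw [pow_succ b j, mul_smul, h1, hsm, hc, h3, hsm, smul_smul, smul_smul,
        Nat.add_sub_add_right, pow_succ b j]

end Serre

/-- The subalgebra generated by `f_1, …, f_n`. -/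
def Um (n : ℕ) : Subalgebra KK G.U := Algebra.adjoin KK {y | ∃ i, 1 ≤ i ∧ i ≤ n ∧ y = G.f i}

lemma Um_mono {n n' : ℕ} (h : n ≤ n') : Um G n ≤ Um G n' :=
  Algebra.adjoin_mono fun _ ⟨i, h1, h2, h3⟩ => ⟨i, h1, h2.trans h, h3⟩

lemma f_mem_Um {i n : ℕ} (h1 : 1 ≤ i) (h2 : i ≤ n) : G.f i ∈ Um G n :=
  Algebra.subset_adjoin ⟨i, h1, h2, rfl⟩

lemma Um_le_Usub (n : ℕ) : Um G n ≤ Usub G n :=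
  Algebra.adjoin_mono fun _ ⟨i, h1, h2, h3⟩ => ⟨i, h1, h2, Or.inr (Or.inl h3)⟩

lemma commute_of_mem_Um {n j : ℕ} (hj : n + 1 < j) (hjd : j ≤ d) {p : G.U} (hp : p ∈ Um G n) :
    Commute (G.f j) p := by
  induction hp using Algebra.adjoin_induction with
  | mem y hy =>
    obtain ⟨i, h1, h2, rfl⟩ := hy
    exact G.comm_f j i (by omega) hjd h1 (by omega) (by omega)
  | algebraMap r => exact (Algebra.commutes r (G.f j)).symm
  | add p q _ _ hp hq => exact hp.add_right hq
  | mul p q _ _ hp hq => exact hp.mul_right hq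

/-- The subalgebra generated by `f_1, …, f_{n+1}` is spanned by products `x f_{n+1}ˡ y` with `x` and
`y` in the subalgebra generated by `f_1, …, f_n`. -/
lemma Um_succ_le_span (n : ℕ) (hn : n + 1 ≤ d) : ∀ p ∈ Um G (n + 1), p ∈ Submodule.span KK
    {z : G.U | ∃ x ∈ Um G n, ∃ y ∈ Um G n, ∃ l : ℕ, z = x * G.f (n + 1) ^ l * y} := by
  induction n with
  | zero =>
    set S := Submodule.span KK
      {z : G.U | ∃ x ∈ Um G 0, ∃ y ∈ Um G 0, ∃ l : ℕ, z = x * G.f (0 + 1) ^ l * y} with hS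
    have hpow : ∀ l, G.f 1 ^ l ∈ S := fun l =>
      Submodule.subset_span ⟨1, one_mem _, 1, one_mem _, l, by simp⟩
    have hle : Um G (0 + 1) ≤ Algebra.adjoin KK {G.f 1} := by
      refine Algebra.adjoin_mono ?_
      rintro y ⟨i, h1, h2, rfl⟩
      rw [show i = 1 by omega]
      exact Set.mem_singleton _
    intro p hp
    have := hle hp
    rw [Algebra.adjoin_singleton_eq_range_aeval] at this
    obtain ⟨P, rfl⟩ := this
    change Polynomial.aeval (G.f 1) P ∈ S
    rw [Polynomial.aeval_eq_sum_range]
    exact Submodule.sum_mem _ fun l _ => Submodule.smul_mem _ _ (hpow l)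
  | succ n ih =>
    have ih := ih (by omega)
    set a := G.f (n + 1)
    set b := G.f (n + 1 + 1)
    set S := Submodule.span KK
      {z : G.U | ∃ x ∈ Um G (n + 1), ∃ y ∈ Um G (n + 1), ∃ l : ℕ, z = x * b ^ l * y} with hS
    have ha : a ∈ Um G (n + 1) := f_mem_Um G (by omega) le_rfl
    have hab := G.serre_f (n + 1) (n + 1 + 1) (by omega) (by omega) (by omega) hn (Or.inl rfl)
    have hba := G.serre_f (n + 1 + 1) (n + 1) (by omega) hn (by omega) (by omega) (Or.inr rfl)
    have hmem : ∀ x ∈ Um G (n + 1), ∀ y ∈ Um G (n + 1), ∀ l, x * b ^ l * y ∈ S :=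
      fun x hx y hy l => Submodule.subset_span ⟨x, hx, y, hy, l, rfl⟩
    have hlr : ∀ x ∈ Um G (n + 1), ∀ y ∈ Um G (n + 1), ∀ s ∈ S, x * s * y ∈ S := by
      intro x hx y hy s hs
      induction hs using Submodule.span_induction with
      | mem s hs =>
        obtain ⟨x', hx', y', hy', l, rfl⟩ := hs
        have := hmem _ (mul_mem hx hx') _ (mul_mem hy' hy) l
        simpa only [mul_assoc] using this
      | zero => simp
      | add s t _ _ hs ht => rw [mul_add, add_mul]; exact add_mem hs ht
      | smul c s _ hs => rw [mul_smul_comm, smul_mul_assoc]; exact Submodule.smul_mem _ _ hs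
    have hbab : ∀ l, b * a * b ^ l ∈ S := by
      intro l
      have h1 : b * a * b ^ l =
          (qz (l + 1))⁻¹ • (b ^ (l + 1) * a + qz l • (a * b ^ (l + 1))) := by
        rw [serre_pow_mul hba, sub_add_cancel, smul_smul, inv_mul_cancel₀ (qz_ne_zero (by omega)),
          one_smul]
      rw [h1]
      refine Submodule.smul_mem _ _ (add_mem ?_ (Submodule.smul_mem _ _ ?_))
      · simpa using hmem 1 (one_mem _) a ha (l + 1)
      · simpa using hmem a ha 1 (one_mem _) (l + 1)
    have hbapb : ∀ r l, b * a ^ r * b ^ l ∈ S := by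
      intro r l
      cases r with
      | zero => simpa [pow_succ'] using hmem 1 (one_mem _) 1 (one_mem _) (l + 1)
      | succ r =>
        rw [serre_mul_pow hab, sub_mul, smul_mul_assoc, smul_mul_assoc]
        refine sub_mem (Submodule.smul_mem _ _ ?_) (Submodule.smul_mem _ _ ?_)
        · simpa [mul_assoc] using hlr (a ^ r) (pow_mem ha r) 1 (one_mem _) _ (hbab l)
        · simpa [mul_assoc, pow_succ'] using
            hmem (a ^ (r + 1)) (pow_mem ha _) 1 (one_mem _) (l + 1)
    have hbx : ∀ x ∈ Um G (n + 1), ∀ y ∈ Um G (n + 1), ∀ l, b * (x * b ^ l * y) ∈ S := by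
      intro x hx y hy l
      have hx' := ih x hx
      clear hx
      induction hx' using Submodule.span_induction with
      | mem x hx =>
        obtain ⟨x1, hx1, y1, hy1, r, rfl⟩ := hx
        have c1 : b * x1 = x1 * b := commute_of_mem_Um G (by omega) hn hx1
        have c2 : y1 * b ^ l = b ^ l * y1 :=
          ((commute_of_mem_Um G (by omega) hn hy1).pow_left l).eq.symm
        have h2 : b * (x1 * a ^ r * y1 * b ^ l * y) = x1 * (b * a ^ r * b ^ l) * (y1 * y) := by
          calc b * (x1 * a ^ r * y1 * b ^ l * y)
              = (b * x1) * a ^ r * (y1 * b ^ l) * y := by simp only [mul_assoc]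
            _ = x1 * (b * a ^ r * b ^ l) * (y1 * y) := by
              rw [c1, c2]
              simp only [mul_assoc]
        rw [h2]
        exact hlr _ (Um_mono G (by omega) hx1) _
          (mul_mem (Um_mono G (by omega) hy1) hy) _ (hbapb r l)
      | zero => simp
      | add x x' _ _ hx hx' => rw [add_mul, add_mul, mul_add]; exact add_mem hx hx'
      | smul c x _ hx =>
        rw [smul_mul_assoc, smul_mul_assoc, mul_smul_comm]
        exact Submodule.smul_mem _ _ hx
    have hb : ∀ s ∈ S, b * s ∈ S := by
      intro s hs
      induction hs using Submodule.span_induction with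
      | mem s hs =>
        obtain ⟨x, hx, y, hy, l, rfl⟩ := hs
        exact hbx x hx y hy l
      | zero => simp
      | add s t _ _ hs ht => rw [mul_add]; exact add_mem hs ht
      | smul c s _ hs => rw [mul_smul_comm]; exact Submodule.smul_mem _ _ hs
    have hall : ∀ p ∈ Um G (n + 1 + 1), ∀ s ∈ S, p * s ∈ S := by
      intro p hp
      induction hp using Algebra.adjoin_induction with
      | mem y hy =>
        obtain ⟨i, h1, h2, rfl⟩ := hy
        rcases Nat.lt_or_ge i (n + 1 + 1) with h3 | h3
        · intro s hs
          simpa using hlr _ (f_mem_Um G h1 (Nat.lt_succ_iff.1 h3)) 1 (one_mem _) s hs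
        · rw [show i = n + 1 + 1 by omega]
          exact hb
      | algebraMap r =>
        intro s hs
        rw [← Algebra.smul_def]
        exact Submodule.smul_mem _ _ hs
      | add p q _ _ hp hq => intro s hs; rw [add_mul]; exact add_mem (hp s hs) (hq s hs)
      | mul p q _ _ hp hq => intro s hs; rw [mul_assoc]; exact hp _ (hq s hs)
    intro p hp
    simpa using hall p hp 1 (by simpa using hmem 1 (one_mem _) 1 (one_mem _) 0)

/-! ### Generation by the vectors `f_n^{(j)} ⋯ f_a^{(j)} v` -/

section Chain

variable {W : Type} [AddCommGroup W] [Module KK W] [Module G.U W] [IsScalarTower KK G.U W]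
  {v : W} {a m : ℕ}

omit [Module KK W] [IsScalarTower KK G.U W] in
lemma fDivChain_pred (ha : 1 ≤ a) (j : ℕ) : fDivChain G (fun _ => j) a (a - 1) v = v := by
  simp [fDivChain, show a - 1 + 1 - a = 0 by omega]

omit [Module KK W] [IsScalarTower KK G.U W] in
lemma fDivChain_succ {n : ℕ} (hn : a ≤ n + 1) (j : ℕ) :
    fDivChain G (fun _ => j) a (n + 1) v =
      fDiv G (n + 1) j • fDivChain G (fun _ => j) a n v := by
  rw [fDivChain, fDivChain, show n + 1 + 1 - a = (n + 1 - a) + 1 by omega, List.range_succ,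
    List.foldl_append]
  simp [show a + (n + 1 - a) = n + 1 by omega]

variable [FiniteDimensional KK W]

lemma f_pow_smul_eq_zero (hv : IsWtVec G v (omWt a m))
    (hw : ∀ i, 1 ≤ i → i ≤ d → G.e i • v = 0) {i n : ℕ} (h1 : 1 ≤ i) (h2 : i ≤ d)
    (hn : omWt a m i < n) : G.f i ^ n • v = 0 := by
  rw [← act_pow]
  exact (isSlTwo_act (W := W) G h1 h2).pow_F_eq_zero (hv i h1 h2) (hw i h1 h2) hn

lemma f_smul_eq_zero (hv : IsWtVec G v (omWt a m))
    (hw : ∀ i, 1 ≤ i → i ≤ d → G.e i • v = 0) {i : ℕ} (h1 : 1 ≤ i) (h2 : i ≤ d)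
    (hi : i ≠ a) : G.f i • v = 0 := by
  have := f_pow_smul_eq_zero G hv hw (n := 1) h1 h2 (by simp [omWt, hi])
  rwa [pow_one] at this

lemma fDivChain_eq_zero (hv : IsWtVec G v (omWt a m))
    (hw : ∀ i, 1 ≤ i → i ≤ d → G.e i • v = 0) (ha : 1 ≤ a) (had : a ≤ d) {j : ℕ} (hj : m < j)
    {n : ℕ} (hn : a ≤ n) : fDivChain G (fun _ => j) a n v = 0 := by
  induction n, hn using Nat.le_induction with
  | base =>
    have := fDivChain_succ G (v := v) (a := a) (n := a - 1) (by omega) j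
    rw [fDivChain_pred G ha, Nat.sub_add_cancel ha, fDiv_smul,
      f_pow_smul_eq_zero G hv hw ha had (by simp [omWt, hj]), smul_zero] at this
    exact this
  | succ n hn ih => rw [fDivChain_succ G (by omega), ih, smul_zero]

omit [Module KK W] [IsScalarTower KK G.U W] [FiniteDimensional KK W] in
lemma fDivChain_mem (ha : 1 ≤ a) {n : ℕ} (hn : a - 1 ≤ n) (j : ℕ) :
    ∃ p ∈ Um G n, fDivChain G (fun _ => j) a n v = p • v := by
  induction n, hn using Nat.le_induction with
  | base => exact ⟨1, one_mem _, by rw [fDivChain_pred G ha, one_smul]⟩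
  | succ n hn ih =>
    obtain ⟨p, hp, hpv⟩ := ih
    refine ⟨fDiv G (n + 1) j * p, mul_mem ?_ (Um_mono G (by omega) hp), ?_⟩
    · exact Subalgebra.smul_mem _ (pow_mem (f_mem_Um G (by omega) le_rfl) _) _
    · rw [fDivChain_succ G (by omega), hpv, smul_smul]

lemma f_smul_fDivChain_eq_zero (hv : IsWtVec G v (omWt a m))
    (hw : ∀ i, 1 ≤ i → i ≤ d → G.e i • v = 0) (ha : 1 ≤ a) {n i : ℕ} (hn : a - 1 ≤ n)
    (hni : n + 1 < i) (hi : i ≤ d) (j : ℕ) : G.f i • fDivChain G (fun _ => j) a n v = 0 := by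
  obtain ⟨p, hp, hpv⟩ := fDivChain_mem G (v := v) ha hn j
  rw [hpv, smul_smul, (commute_of_mem_Um G hni hi hp).eq, mul_smul,
    f_smul_eq_zero G hv hw (by omega) hi (by omega), smul_zero]

lemma exists_f_pow_smul_fDivChain (hv : IsWtVec G v (omWt a m))
    (hw : ∀ i, 1 ≤ i → i ≤ d → G.e i • v = 0) (ha : 1 ≤ a) {n : ℕ} (hn : a - 1 ≤ n) :
    n + 1 ≤ d → ∀ i j : ℕ, ∃ p ∈ Um G n, G.f (n + 1) ^ j • fDivChain G (fun _ => i) a n v =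
      p • fDivChain G (fun _ => j) a (n + 1) v := by
  have hdiv : ∀ (n j : ℕ) (x : W), G.f n ^ j • x = qFact j • fDiv G n j • x := by
    intro n j x
    rw [fDiv_smul, smul_smul, mul_inv_cancel₀ (qFact_ne_zero j), one_smul]
  induction n, hn using Nat.le_induction with
  | base =>
    intro _ i j
    refine ⟨algebraMap KK G.U (qFact j), Subalgebra.algebraMap_mem _ _, ?_⟩
    rw [fDivChain_succ G (by omega), fDivChain_pred G ha, fDivChain_pred G ha, algebraMap_smul,
      hdiv]
  | succ n hn ih =>
    intro hnd i j
    obtain ⟨p, hp, hpv⟩ := ih (by omega) i j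
    have hz := f_smul_fDivChain_eq_zero G hv hw ha hn (Nat.lt_succ_self (n + 1)) hnd i
    obtain ⟨c, hc⟩ := exists_pow_smul_pow_smul_eq
      (G.serre_f (n + 1) (n + 1 + 1) (by omega) (by omega) (by omega) hnd (Or.inl rfl))
      (G.serre_f (n + 1 + 1) (n + 1) (by omega) hnd (by omega) (by omega) (Or.inr rfl)) j i _ hz
    have hcomm := (commute_of_mem_Um G (Nat.lt_succ_self (n + 1)) hnd hp).pow_left j
    refine ⟨((qFact i)⁻¹ * c * qFact j) • (G.f (n + 1) ^ (i - j) * p),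
      Subalgebra.smul_mem _ (mul_mem (pow_mem (f_mem_Um G (by omega) le_rfl) _)
        (Um_mono G (by omega) hp)) _, ?_⟩
    rw [fDivChain_succ G (n := n) (by omega), fDiv_smul, smul_smul_comm', hc, hpv,
      smul_smul (G.f (n + 1 + 1) ^ j) p, hcomm.eq, mul_smul, hdiv (n + 1 + 1),
      ← fDivChain_succ G (by omega), smul_smul_comm', smul_smul_comm', smul_smul, smul_smul,
      smul_assoc, mul_smul (G.f (n + 1) ^ (i - j))]

lemma smul_mem_span_fDivChain (hv : IsWtVec G v (omWt a m))
    (hw : ∀ i, 1 ≤ i → i ≤ d → G.e i • v = 0) (ha : 1 ≤ a) {n : ℕ} (hn : a - 1 ≤ n) :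
    n ≤ d → ∀ p ∈ Um G n, p • v ∈ Submodule.span KK
      {x : W | ∃ r ∈ Um G (n - 1), ∃ i : ℕ, x = r • fDivChain G (fun _ => i) a n v} := by
  induction n, hn using Nat.le_induction with
  | base =>
    intro had p hp
    have h1 : ∃ c : KK, p • v = c • v := by
      induction hp using Algebra.adjoin_induction with
      | mem y hy =>
        obtain ⟨i, h1, h2, rfl⟩ := hy
        exact ⟨0, by rw [f_smul_eq_zero G hv hw h1 (by omega) (by omega), zero_smul]⟩
      | algebraMap r => exact ⟨r, algebraMap_smul _ _ _⟩
      | add p q _ _ hp hq =>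
        obtain ⟨c, hc⟩ := hp
        obtain ⟨c', hc'⟩ := hq
        exact ⟨c + c', by rw [add_smul, add_smul, hc, hc']⟩
      | mul p q _ _ hp hq =>
        obtain ⟨c, hc⟩ := hp
        obtain ⟨c', hc'⟩ := hq
        exact ⟨c' * c, by rw [mul_smul, hc', smul_smul_comm', hc, smul_smul]⟩
    obtain ⟨c, hc⟩ := h1
    rw [hc]
    exact Submodule.smul_mem _ _ (Submodule.subset_span
      ⟨1, one_mem _, 0, by rw [fDivChain_pred G ha, one_smul]⟩)
  | succ n hn ih =>
    intro hnd p hp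
    set S := Submodule.span KK
      {x : W | ∃ r ∈ Um G (n + 1 - 1), ∃ i : ℕ, x = r • fDivChain G (fun _ => i) a (n + 1) v}
    have key : ∀ x ∈ Um G n, ∀ l : ℕ, ∀ w ∈ Submodule.span KK
        {x : W | ∃ r ∈ Um G (n - 1), ∃ i : ℕ, x = r • fDivChain G (fun _ => i) a n v},
        x • G.f (n + 1) ^ l • w ∈ S := by
      intro x hx l w hw'
      induction hw' using Submodule.span_induction with
      | mem w hw' =>
        obtain ⟨r, hr, i, rfl⟩ := hw'
        obtain ⟨p, hp, hpv⟩ := exists_f_pow_smul_fDivChain G hv hw ha hn hnd i l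
        have hcomm : G.f (n + 1) ^ l * r = r * G.f (n + 1) ^ l := by
          rcases Nat.eq_zero_or_pos n with rfl | hn0
          · induction hr using Algebra.adjoin_induction with
            | mem y hy =>
              obtain ⟨i, h1, h2, rfl⟩ := hy
              omega
            | algebraMap c => exact (Algebra.commutes c _).symm
            | add p q _ _ hp hq => rw [mul_add, add_mul, hp, hq]
            | mul p q _ _ hp hq => rw [← mul_assoc, hp, mul_assoc, hq, mul_assoc]
          · exact ((commute_of_mem_Um G (by omega) hnd hr).pow_left l).eq
        rw [smul_smul (G.f (n + 1) ^ l), hcomm, mul_smul, hpv, smul_smul, smul_smul]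
        exact Submodule.subset_span
          ⟨_, mul_mem (mul_mem hx (Um_mono G (by omega) hr)) hp, l, rfl⟩
      | zero => simp
      | add w w' _ _ h h' => rw [smul_add, smul_add]; exact add_mem h h'
      | smul c w _ h => rw [smul_smul_comm', smul_smul_comm']; exact Submodule.smul_mem _ _ h
    have hp' := Um_succ_le_span G n hnd p hp
    clear hp
    induction hp' using Submodule.span_induction with
    | mem p hp =>
      obtain ⟨x, hx, y, hy, l, rfl⟩ := hp
      rw [mul_smul, mul_smul]
      exact key x hx l _ (ih (by omega) y hy)
    | zero => simp
    | add p q _ _ hp hq => rw [add_smul]; exact add_mem hp hq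
    | smul c p _ hp => rw [smul_assoc]; exact Submodule.smul_mem _ _ hp

omit [Module KK W] [IsScalarTower KK G.U W] [FiniteDimensional KK W] in
lemma FMon.exists_mem_Um {c : ℕ → ℤ} {x : W} (hx : FMon G v c x) : ∃ p ∈ Um G d, x = p • v := by
  induction hx with
  | base => exact ⟨1, one_mem _, (one_smul _ _).symm⟩
  | step i h1 h2 _ ih =>
    obtain ⟨p, hp, rfl⟩ := ih
    exact ⟨_, mul_mem (f_mem_Um G h1 h2) hp, smul_smul _ _ _⟩

/-- The module of highest weight `m ω_a` is the sum of the submodules over the smaller quantum group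
generated by the vectors `f_d^{(j)} ⋯ f_a^{(j)} v`. -/
lemma iSup_USpan_eq_top (hV : IsHWModule G (omWt a m) v) (ha : 1 ≤ a) (had : a ≤ d) :
    ⨆ j : Fin (m + 1), USpan G (d - 1) (fDivChain G (fun _ => j.1) a d v) = ⊤ := by
  rw [eq_top_iff, ← span_FMon_eq_top G hV.wt hV.hw hV.gen]
  refine Submodule.span_le.2 ?_
  rintro x ⟨c, hx⟩
  obtain ⟨p, hp, rfl⟩ := hx.exists_mem_Um G
  refine Submodule.span_le.2 ?_
    (smul_mem_span_fDivChain G hV.wt hV.hw ha (show a - 1 ≤ d by omega) le_rfl p hp)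
  rintro _ ⟨r, hr, i, rfl⟩
  rcases Nat.lt_or_ge m i with h | h
  · rw [fDivChain_eq_zero G hV.wt hV.hw ha had h had, smul_zero]
    exact zero_mem _
  · exact Submodule.mem_iSup_of_mem (⟨i, by omega⟩ : Fin (m + 1))
      (Submodule.subset_span ⟨r, Um_le_Usub G _ hr, rfl⟩)

end Chain

/-! ### Independence of submodules of different content -/

section Independence

variable {W : Type} [AddCommGroup W] [Module KK W] [Module G.U W] [IsScalarTower KK G.U W]
  {v : W} {lam : ℕ → ℤ}

/-- The action of `q^h` for `h = ∑_{t ≤ n} t h_t`. -/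
def weightOp (W : Type) [AddCommGroup W] [Module KK W] [Module G.U W] [IsScalarTower KK G.U W] :
    ℕ → Module.End KK W
  | 0 => 1
  | n + 1 => act G W (G.K (n + 1) ^ (n + 1)) * weightOp W n

lemma weightOp_apply {x : W} {μ : ℕ → ℤ} (hx : IsWtVec G x μ) {n : ℕ} (hn : n ≤ d) :
    weightOp G W n x = qv ^ (∑ t ∈ Finset.Icc 1 n, t * μ t) • x := by
  induction n with
  | zero => simp [weightOp]
  | succ n ih =>
    have hK : ∀ r : ℕ, G.K (n + 1) ^ r • x = qv ^ (r * μ (n + 1)) • x := by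
      intro r
      induction r with
      | zero => simp
      | succ r ihr =>
        rw [pow_succ', mul_smul, ihr, smul_smul_comm', hx (n + 1) (by omega) hn, smul_smul,
          ← zpow_add₀ qv_ne_zero]
        congr 2
        push_cast
        ring
    rw [weightOp, Module.End.mul_apply, ih (by omega), map_smul, act_apply, hK, smul_smul,
      ← zpow_add₀ qv_ne_zero, Finset.sum_Icc_succ_top (by omega)]

lemma sum_mul_cartan (n : ℕ) {s : ℕ} (hs : 1 ≤ s) :
    ∑ t ∈ Finset.Icc 1 n, (t : ℤ) * cartan t s =
      if n = s then (n : ℤ) + 1 else if n + 1 = s then -(n : ℤ) else 0 := by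
  induction n with
  | zero => simp; omega
  | succ n ih =>
    rw [Finset.sum_Icc_succ_top (by omega), ih]
    unfold cartan
    push_cast
    split_ifs <;> omega

lemma sum_mul_wtSub (hd : 1 ≤ d) (c : ℕ → ℤ) :
    ∑ t ∈ Finset.Icc 1 d, (t : ℤ) * wtSub d lam c t =
      ∑ t ∈ Finset.Icc 1 d, (t : ℤ) * lam t - (d + 1) * c d := by
  have h1 : ∑ t ∈ Finset.Icc 1 d, (t : ℤ) * ∑ s ∈ Finset.Icc 1 d, c s * cartan t s =
      (d + 1) * c d := by
    simp only [Finset.mul_sum]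
    rw [Finset.sum_comm]
    have h2 : ∀ s ∈ Finset.Icc 1 d, ∑ t ∈ Finset.Icc 1 d, (t : ℤ) * (c s * cartan t s) =
        if d = s then (d + 1) * c d else 0 := by
      intro s hs
      have hs := Finset.mem_Icc.1 hs
      have h3 := sum_mul_cartan d hs.1
      simp only [mul_left_comm _ (c s)]
      rw [← Finset.mul_sum, h3]
      split_ifs with h4 h5
      · rw [h4]; ring
      · omega
      · ring
    rw [Finset.sum_congr rfl h2, Finset.sum_ite_eq, if_pos (Finset.mem_Icc.2 ⟨hd, le_rfl⟩)]
  rw [← h1, ← Finset.sum_sub_distrib]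
  refine Finset.sum_congr rfl fun t _ => ?_
  rw [wtSub, mul_sub]

lemma fSpace_le_eigenspace (hd : 1 ≤ d) (hv : IsWtVec G v lam) (c : ℕ → ℤ) :
    fSpace G v c ≤ Module.End.eigenspace (weightOp G W d)
      (qv ^ (∑ t ∈ Finset.Icc 1 d, (t : ℤ) * lam t - (d + 1) * c d)) := by
  intro x hx
  rw [Module.End.mem_eigenspace_iff, weightOp_apply G (isWtVec_of_mem_fSpace G hv hx) le_rfl,
    sum_mul_wtSub hd]

lemma iSupIndep_of_le_fSpace (hd : 1 ≤ d) (hv : IsWtVec G v lam) {ι : Type}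
    (S : ι → Submodule KK W) (w : ι → ℤ) (hw : Function.Injective w)
    (hS : ∀ j, S j ≤ ⨆ c : {c : ℕ → ℤ // c d = w j}, fSpace G v c.1) : iSupIndep S := by
  have h1 := (Module.End.eigenspaces_iSupIndep (weightOp G W d)).comp (f := fun j =>
    qv ^ (∑ t ∈ Finset.Icc 1 d, (t : ℤ) * lam t - (d + 1) * w j)) (by
      intro i j hij
      have h2 := qv_zpow_injective hij
      have h3 : ((d : ℤ) + 1) * w i = (d + 1) * w j := by linarith
      exact hw (mul_left_cancel₀ (by omega) h3))
  refine h1.mono fun j => (hS j).trans (iSup_le fun c => ?_)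
  have := fSpace_le_eigenspace G hd hv c.1
  rwa [c.2] at this

lemma fDivChain_mem_fSpace {a : ℕ} (ha : 1 ≤ a) (j : ℕ) {n : ℕ} (hn : a - 1 ≤ n) (hnd : n ≤ d) :
    fDivChain G (fun _ => j) a n v ∈
      fSpace G v (fun t => if a ≤ t ∧ t ≤ n then (j : ℤ) else 0) := by
  induction n, hn using Nat.le_induction with
  | base =>
    rw [fDivChain_pred G ha]
    have : (fun t => if a ≤ t ∧ t ≤ a - 1 then (j : ℤ) else 0) = 0 := by
      funext t
      exact if_neg (by omega)
    rw [this]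
    exact Submodule.subset_span FMon.base
  | succ n hn ih =>
    rw [fDivChain_succ G (by omega)]
    have h1 := pow_f_smul_mem_fSpace G (i := n + 1) (by omega) hnd (ih (by omega)) j
    convert h1 using 2
    funext t
    rcases eq_or_ne t (n + 1) with rfl | ht
    · simp
      omega
    · simp [Pi.single_eq_of_ne ht]
      congr 1
      simp
      omega

end Independence

/-! ### Restriction to a smaller quantum group -/

section Restriction

variable {n : ℕ} (H : QGroup n)
  {W : Type} [AddCommGroup W] [Module KK W] [Module G.U W] [IsScalarTower KK G.U W] {v : W}
  {X : Type} [AddCommGroup X] [Module KK X] [Module H.U X] [IsScalarTower KK H.U X] {u : X}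

/-- `φ` commutes with the action of the generators of the smaller quantum group. -/
structure Intertwines (φ : X →ₗ[KK] W) : Prop where
  e : ∀ i, 1 ≤ i → i ≤ n → ∀ x, φ (H.e i • x) = G.e i • φ x
  f : ∀ i, 1 ≤ i → i ≤ n → ∀ x, φ (H.f i • x) = G.f i • φ x
  K : ∀ i, 1 ≤ i → i ≤ n → ∀ x, φ (H.K i • x) = G.K i • φ x
  Kinv : ∀ i, 1 ≤ i → i ≤ n → ∀ x, φ (H.Kinv i • x) = G.Kinv i • φ x

variable {G H} {φ : X →ₗ[KK] W} {lam μ c₀ : ℕ → ℤ}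

omit [IsScalarTower KK G.U W] [IsScalarTower KK H.U X] in
lemma map_pow_smul {y : H.U} {y' : G.U} (h : ∀ x, φ (y • x) = y' • φ x) (r : ℕ) (x : X) :
    φ (y ^ r • x) = y' ^ r • φ x := by
  induction r with
  | zero => simp
  | succ r ih => rw [pow_succ', pow_succ', mul_smul, mul_smul, h, ih]

omit [IsScalarTower KK G.U W] [IsScalarTower KK H.U X] in
lemma map_Llat_le (hu' : ∀ x ∈ latticeGens H u, φ x ∈ latticeGens G v) :
    Submodule.map (toA0Linear φ) (Llat H u) ≤ Llat G v := by
  rw [Llat, Submodule.map_span]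
  refine Submodule.span_mono ?_
  rintro _ ⟨x, hx, rfl⟩
  exact hu' x hx

omit [IsScalarTower KK G.U W] [IsScalarTower KK H.U X] in
lemma map_mem_qLmod (hu' : ∀ x ∈ latticeGens H u, φ x ∈ latticeGens G v) {x : X}
    (hx : x ∈ qLmod H u) : φ x ∈ qLmod G v := by
  obtain ⟨y, hy, rfl⟩ := hx
  exact ⟨φ y, map_Llat_le hu' ⟨y, hy, rfl⟩, (φ.map_smul qv y).symm⟩

namespace Intertwines

variable (hφ : Intertwines G H φ)
include hφ

lemma fDiv_smul {i : ℕ} (h1 : 1 ≤ i) (h2 : i ≤ n) (r : ℕ) (x : X) :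
    φ (fDiv H i r • x) = fDiv G i r • φ x := by
  rw [QSL.fDiv_smul, QSL.fDiv_smul, map_smul, map_pow_smul (hφ.f i h1 h2)]

omit [IsScalarTower KK H.U X] in
lemma map_FMon (hnd : n ≤ d) (hu : φ u ∈ fSpace G v c₀) {c : ℕ → ℤ} {x : X} (hx : FMon H u c x) :
    φ x ∈ fSpace G v (c₀ + c) ∧ ∀ t, n < t → c t = 0 := by
  induction hx with
  | base => simpa using hu
  | @step c x i h1 h2 _ ih =>
    refine ⟨?_, fun t ht => ?_⟩
    · rw [hφ.f i h1 h2, ← add_assoc]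
      exact f_smul_mem_fSpace G h1 (h2.trans hnd) ih.1
    · simp [ih.2 t ht, Pi.single_eq_of_ne (show t ≠ i by omega)]

omit [IsScalarTower KK H.U X] in
lemma map_mem_fSpace (hnd : n ≤ d) (hu : φ u ∈ fSpace G v c₀) {c : ℕ → ℤ} {x : X}
    (hx : x ∈ fSpace H u c) : φ x ∈ fSpace G v (c₀ + c) := by
  induction hx using Submodule.span_induction with
  | mem x hx => exact (hφ.map_FMon hnd hu hx).1
  | zero => simp
  | add x y _ _ hx hy => rw [map_add]; exact add_mem hx hy
  | smul a x _ hx => rw [map_smul]; exact Submodule.smul_mem _ _ hx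

lemma range_le_iSup_fSpace (hnd : n < d) (hX : IsHWModule H μ u) (hu : φ u ∈ fSpace G v c₀) :
    LinearMap.range φ ≤ ⨆ c : {c : ℕ → ℤ // c d = c₀ d}, fSpace G v c.1 := by
  rw [LinearMap.range_eq_map, ← span_FMon_eq_top H hX.wt hX.hw hX.gen, Submodule.map_span]
  refine Submodule.span_le.2 ?_
  rintro _ ⟨x, ⟨c, hx⟩, rfl⟩
  obtain ⟨h1, h2⟩ := hφ.map_FMon hnd.le hu hx
  exact Submodule.mem_iSup_of_mem (⟨c₀ + c, by simp [h2 d hnd]⟩ : {c : ℕ → ℤ // c d = c₀ d}) h1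

/-- `φ` commutes with the Kashiwara operators. -/
lemma map_kashF [FiniteDimensional KK W] (hnd : n ≤ d) (hv : IsWtVec G v lam)
    (hw : ∀ i, 1 ≤ i → i ≤ d → G.e i • v = 0) (hX : IsHWModule H μ u)
    (hu : φ u ∈ fSpace G v c₀) {i : ℕ} (h1 : 1 ≤ i) (h2 : i ≤ n) {c : ℕ → ℤ} {x : X}
    (hx : x ∈ fSpace H u c) : φ (kashF H i x) = kashF G i (φ x) := by
  have := hX.findim
  obtain ⟨N, t, ht, hs⟩ := exists_decomp_of_mem_fSpace H hX.wt hX.hw h1 h2 hx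
  rw [kashF_eq_of_mem H hX.wt hX.hw h1 h2 hx (N + 1) t ht hs,
    kashF_eq_of_mem G hv hw h1 (h2.trans hnd) (hφ.map_mem_fSpace hnd hu hx) (N + 1)
      (fun r => φ (t r)), map_sum]
  · exact Finset.sum_congr rfl fun r _ => hφ.fDiv_smul h1 h2 _ _
  · intro r
    refine ⟨?_, by rw [← hφ.e i h1 h2, (ht r).2, map_zero]⟩
    rw [add_sub_assoc]
    exact hφ.map_mem_fSpace hnd hu (ht r).1
  · rw [hs, map_sum]
    exact Finset.sum_congr rfl fun r _ => hφ.fDiv_smul h1 h2 _ _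

lemma map_mem_latticeGens [FiniteDimensional KK W] (hnd : n ≤ d) (hv : IsWtVec G v lam)
    (hw : ∀ i, 1 ≤ i → i ≤ d → G.e i • v = 0) (hX : IsHWModule H μ u)
    (hu : φ u ∈ fSpace G v c₀) (hu' : φ u ∈ latticeGens G v) {x : X}
    (hx : x ∈ latticeGens H u) : φ x ∈ latticeGens G v := by
  have := hX.findim
  obtain ⟨c, hc⟩ := exists_KMon H hx
  clear hx
  induction hc with
  | base => exact hu'
  | step i h1 h2 hx ih =>
    rw [hφ.map_kashF hnd hv hw hX hu h1 h2 (hx.mem_fSpace H hX.wt hX.hw)]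
    exact kashF_mem_latticeGens G h1 (h2.trans hnd) ih

omit [IsScalarTower KK G.U W] in
/-- `φ` intertwines the bar involutions. -/
lemma map_psi (hnd : n ≤ d) (hX : IsHWModule H μ u) {barK : KK →+* KK} {psi : W →+ W}
    {psihat : X →+ X} (hpsi : IsPsi G v barK psi) (hpsihat : IsPsi H u barK psihat)
    (hu : psi (φ u) = φ u) (x : X) : psi (φ x) = φ (psihat x) := by
  obtain ⟨-, p2, p3, p4, p5, p6⟩ := hpsi
  obtain ⟨s1, s2, s3, s4, s5, s6⟩ := hpsihat
  have key : ∀ p : H.U, ∀ x, psi (φ x) = φ (psihat x) → psi (φ (p • x)) = φ (psihat (p • x)) := by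
    intro p
    induction H.gen p using Algebra.adjoin_induction with
    | mem y hy =>
      intro x hx
      obtain ⟨i, h1, h2, rfl | rfl | rfl | rfl⟩ := hy
      · rw [hφ.e i h1 h2, p3 i h1 (h2.trans hnd), hx, s3 i h1 h2, hφ.e i h1 h2]
      · rw [hφ.f i h1 h2, p4 i h1 (h2.trans hnd), hx, s4 i h1 h2, hφ.f i h1 h2]
      · rw [hφ.K i h1 h2, p5 i h1 (h2.trans hnd), hx, s5 i h1 h2, hφ.Kinv i h1 h2]
      · rw [hφ.Kinv i h1 h2, p6 i h1 (h2.trans hnd), hx, s6 i h1 h2, hφ.K i h1 h2]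
    | algebraMap r => intro x hx; simp only [algebraMap_smul, map_smul, p2, s2, hx]
    | add p q _ _ hp hq => intro x hx; simp only [add_smul, map_add, hp x hx, hq x hx]
    | mul p q _ _ hp hq => intro x hx; rw [mul_smul]; exact hp _ (hq x hx)
  obtain ⟨p, rfl⟩ := hX.gen x
  exact key p u (by rw [hu, s1])

end Intertwines
end Restriction

/-! ### The vectors `f_n^{(j)} ⋯ f_a^{(j)} v` in the crystal -/

section ChainCrystal

variable {W : Type} [AddCommGroup W] [Module KK W] [Module G.U W] [IsScalarTower KK G.U W]
  {v : W} {lam : ℕ → ℤ} {a : ℕ}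

lemma e_commute_of_mem_Um {n : ℕ} (hnd : n + 1 ≤ d) {p : G.U} (hp : p ∈ Um G n) :
    Commute (G.e (n + 1)) p := by
  induction hp using Algebra.adjoin_induction with
  | mem y hy =>
    obtain ⟨i, h1, h2, rfl⟩ := hy
    have := G.e_f_comm (n + 1) i (by omega) hnd h1 (by omega)
    rw [if_neg (by omega)] at this
    exact sub_eq_zero.1 this
  | algebraMap r => exact (Algebra.commutes r _).symm
  | add p q _ _ hp hq => exact hp.add_right hq
  | mul p q _ _ hp hq => exact hp.mul_right hq

omit [Module KK W] [IsScalarTower KK G.U W] in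
lemma e_smul_fDivChain_eq_zero (hw : ∀ i, 1 ≤ i → i ≤ d → G.e i • v = 0) (ha : 1 ≤ a) {n : ℕ}
    (hn : a - 1 ≤ n) (hnd : n + 1 ≤ d) (j : ℕ) :
    G.e (n + 1) • fDivChain G (fun _ => j) a n v = 0 := by
  obtain ⟨p, hp, hpv⟩ := fDivChain_mem G (v := v) ha hn j
  rw [hpv, smul_smul, (e_commute_of_mem_Um G hnd hp).eq, mul_smul, hw _ (by omega) hnd, smul_zero]

lemma kashF_fDiv_smul [FiniteDimensional KK W] (hv : IsWtVec G v lam)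
    (hw : ∀ i, 1 ≤ i → i ≤ d → G.e i • v = 0) {i : ℕ} (h1 : 1 ≤ i) (h2 : i ≤ d) {c : ℕ → ℤ} {x : W}
    (hx : x ∈ fSpace G v c) (he : G.e i • x = 0) (r : ℕ) :
    kashF G i (fDiv G i r • x) = fDiv G i (r + 1) • x := by
  rw [kashF_eq_of_mem G hv hw h1 h2 (pow_f_smul_mem_fSpace G h1 h2 hx r) (r + 1)
    (fun t => if t = r then x else 0)]
  · rw [Finset.sum_eq_single r]
    · rw [if_pos rfl]
    · intro t _ ht
      rw [if_neg ht, smul_zero]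
    · simp
  · intro t
    split_ifs with h
    · subst h
      rw [add_sub_cancel_right]
      exact ⟨hx, he⟩
    · exact ⟨zero_mem _, smul_zero _⟩
  · rw [Finset.sum_eq_single r]
    · rw [if_pos rfl]
    · intro t _ ht
      rw [if_neg ht, smul_zero]
    · simp

lemma fDivChain_mem_latticeGens [FiniteDimensional KK W] (hv : IsWtVec G v lam)
    (hw : ∀ i, 1 ≤ i → i ≤ d → G.e i • v = 0) (ha : 1 ≤ a) (j : ℕ) {n : ℕ} (hn : a - 1 ≤ n)
    (hnd : n ≤ d) : fDivChain G (fun _ => j) a n v ∈ latticeGens G v := by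
  induction n, hn using Nat.le_induction with
  | base =>
    rw [fDivChain_pred G ha]
    exact self_mem_latticeGens G
  | succ n hn ih =>
    rw [fDivChain_succ G (by omega)]
    have hr : ∀ r, fDiv G (n + 1) r • fDivChain G (fun _ => j) a n v ∈ latticeGens G v := by
      intro r
      induction r with
      | zero => simpa [fDiv, qFact] using ih (by omega)
      | succ r ihr =>
        rw [← kashF_fDiv_smul G hv hw (by omega) hnd
          (fDivChain_mem_fSpace G ha j hn (by omega)) (e_smul_fDivChain_eq_zero G hw ha hn hnd j)]
        exact kashF_mem_latticeGens G (by omega) hnd ihr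
    exact hr j

lemma fDiv_mem_UAring {i : ℕ} (h1 : 1 ≤ i) (h2 : i ≤ d) (r : ℕ) : fDiv G i r ∈ UAring G :=
  Subring.subset_closure (Or.inl (Or.inr ⟨i, r, h1, h2, Or.inr rfl⟩))

omit [Module KK W] [IsScalarTower KK G.U W] in
lemma fDivChain_mem_UAv (ha : 1 ≤ a) (j : ℕ) {n : ℕ} (hn : a - 1 ≤ n) (hnd : n ≤ d) :
    fDivChain G (fun _ => j) a n v ∈ UAv G v := by
  induction n, hn using Nat.le_induction with
  | base => exact ⟨1, one_mem _, by rw [fDivChain_pred G ha, one_smul]⟩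
  | succ n hn ih =>
    obtain ⟨p, hp, hpv⟩ := ih (by omega)
    refine ⟨fDiv G (n + 1) j * p, mul_mem (fDiv_mem_UAring G (by omega) hnd j) hp, ?_⟩
    rw [fDivChain_succ G (by omega), hpv, mul_smul]

lemma barK_qFact {barK : KK →+* KK} (hbar : IsBarK barK) (r : ℕ) : barK (qFact r) = qFact r := by
  induction r with
  | zero => simp [qFact]
  | succ r ih =>
    rw [qFact, map_mul, ih, qInt, map_div₀, map_sub, map_sub, map_pow, map_pow, map_inv₀, hbar.1,
      inv_inv, ← neg_sub qv, ← neg_sub (qv ^ (r + 1)), neg_div_neg_eq]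

lemma psi_fDivChain {barK : KK →+* KK} (hbar : IsBarK barK) {psi : W →+ W}
    (hpsi : IsPsi G v barK psi) (ha : 1 ≤ a) (j : ℕ) {n : ℕ} (hn : a - 1 ≤ n) (hnd : n ≤ d) :
    psi (fDivChain G (fun _ => j) a n v) = fDivChain G (fun _ => j) a n v := by
  obtain ⟨p1, p2, -, p4, -⟩ := hpsi
  induction n, hn using Nat.le_induction with
  | base => rw [fDivChain_pred G ha, p1]
  | succ n hn ih =>
    have hf : ∀ (r : ℕ) (x : W), psi (G.f (n + 1) ^ r • x) = G.f (n + 1) ^ r • psi x := by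
      intro r x
      induction r with
      | zero => simp
      | succ r ihr => rw [pow_succ', mul_smul, mul_smul, p4 _ (by omega) hnd, ihr]
    rw [fDivChain_succ G (by omega), fDiv_smul, p2, hf, ih (by omega), map_inv₀, barK_qFact hbar]

end ChainCrystal

/-! ### Integral forms and restriction -/

section Integral

variable {n : ℕ} {G} {H : QGroup n}
  {W : Type} [AddCommGroup W] [Module KK W] [Module G.U W] [IsScalarTower KK G.U W] {v : W}
  {X : Type} [AddCommGroup X] [Module KK X] [Module H.U X] [IsScalarTower KK H.U X] {u : X}
  {φ : X →ₗ[KK] W}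

/-- `φ` carries the action of `p` to the action of `p'`. -/
def Carries (φ : X →ₗ[KK] W) (p : H.U) (p' : G.U) : Prop := ∀ x, φ (p • x) = p' • φ x

namespace Carries

omit [IsScalarTower KK G.U W] [IsScalarTower KK H.U X] in
lemma one : Carries φ (1 : H.U) (1 : G.U) := fun x => by rw [one_smul, one_smul]

omit [IsScalarTower KK G.U W] [IsScalarTower KK H.U X] in
lemma mul {p q : H.U} {p' q' : G.U} (hp : Carries φ p p') (hq : Carries φ q q') :
    Carries φ (p * q) (p' * q') := fun x => by rw [mul_smul, mul_smul, hp, hq]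

omit [IsScalarTower KK G.U W] [IsScalarTower KK H.U X] in
lemma sub {p q : H.U} {p' q' : G.U} (hp : Carries φ p p') (hq : Carries φ q q') :
    Carries φ (p - q) (p' - q') := fun x => by rw [sub_smul, sub_smul, map_sub, hp, hq]

lemma smul {p : H.U} {p' : G.U} (c : KK) (hp : Carries φ p p') :
    Carries φ (c • p) (c • p') := fun x => by rw [smul_assoc, smul_assoc, map_smul, hp]

omit [IsScalarTower KK G.U W] [IsScalarTower KK H.U X] in
lemma list_prod {ι : Type} (l : List ι) {p : ι → H.U} {p' : ι → G.U}
    (hp : ∀ i ∈ l, Carries φ (p i) (p' i)) :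
    Carries φ (l.map p).prod (l.map p').prod := by
  induction l with
  | nil => exact one
  | cons i l ih =>
    rw [List.map_cons, List.map_cons, List.prod_cons, List.prod_cons]
    exact (hp i (by simp)).mul (ih fun i hi => hp i (by simp [hi]))

end Carries

omit [IsScalarTower KK G.U W] [IsScalarTower KK H.U X] in
lemma Intertwines.carries_KmonZ (hφ : Intertwines G H φ) (hnd : n ≤ d) (c : ℕ → ℤ) :
    Carries φ (KmonZ H c) (KmonZ G fun t => if t ≤ n then c t else 0) := by
  have h1 : KmonZ G (fun t => if t ≤ n then c t else 0) =
      ((List.range n).map fun t => zKpow G (t + 1) (c (t + 1))).prod := by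
    have h2 : ∀ r, n ≤ r → ((List.range r).map fun t =>
        zKpow G (t + 1) (if t + 1 ≤ n then c (t + 1) else 0)).prod =
          ((List.range n).map fun t => zKpow G (t + 1) (c (t + 1))).prod := by
      intro r hr
      induction r, hr using Nat.le_induction with
      | base =>
        refine congrArg _ (List.map_congr_left fun t ht => ?_)
        rw [if_pos (Nat.succ_le_of_lt (List.mem_range.1 ht))]
      | succ r hr ih =>
        rw [List.range_succ, List.map_append, List.prod_append, ih]
        simp [zKpow, show ¬ r < n by omega]
    exact h2 d hnd
  rw [h1, KmonZ]
  refine Carries.list_prod _ fun i hi => ?_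
  have hi := List.mem_range.1 hi
  intro x
  unfold zKpow
  split_ifs
  · exact map_pow_smul (hφ.K (i + 1) (by omega) (by omega)) _ x
  · exact map_pow_smul (hφ.Kinv (i + 1) (by omega) (by omega)) _ x

lemma Intertwines.exists_carries (hφ : Intertwines G H φ) (hnd : n ≤ d) {p : H.U}
    (hp : p ∈ UAring H) : ∃ p' ∈ UAring G, Carries φ p p' := by
  induction hp using Subring.closure_induction with
  | mem p hp =>
    obtain (⟨y, hy, rfl⟩ | ⟨i, r, h1, h2, rfl | rfl⟩) | ⟨c, rfl | ⟨r, rfl⟩⟩ := hp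
    · exact ⟨algebraMap KK G.U y, Subring.subset_closure (Or.inl (Or.inl ⟨y, hy, rfl⟩)),
        fun x => by rw [algebraMap_smul, algebraMap_smul, map_smul]⟩
    · exact ⟨eDiv G i r,
        Subring.subset_closure (Or.inl (Or.inr ⟨i, r, h1, h2.trans hnd, Or.inl rfl⟩)),
        Carries.smul _ (map_pow_smul (hφ.e i h1 h2) r)⟩
    · exact ⟨fDiv G i r, fDiv_mem_UAring G h1 (h2.trans hnd) r, hφ.fDiv_smul h1 h2 r⟩
    · exact ⟨_, Subring.subset_closure (Or.inr ⟨_, Or.inl rfl⟩), hφ.carries_KmonZ hnd c⟩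
    · refine ⟨qhDiv G (fun t => if t ≤ n then c t else 0) r,
        Subring.subset_closure (Or.inr ⟨_, Or.inr ⟨r, rfl⟩⟩), Carries.smul _
          (Carries.list_prod _ fun s _ => Carries.smul _ (Carries.sub (Carries.smul _ ?_)
            (Carries.smul _ ?_)))⟩
      · exact hφ.carries_KmonZ hnd c
      · have := hφ.carries_KmonZ hnd fun t => -c t
        convert this using 3 with t
        by_cases ht : t ≤ n <;> simp [ht]
  | zero => exact ⟨0, zero_mem _, fun x => by rw [zero_smul, zero_smul, map_zero]⟩
  | one => exact ⟨1, one_mem _, Carries.one⟩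
  | add p q _ _ hp hq =>
    obtain ⟨p', hp', h⟩ := hp
    obtain ⟨q', hq', h'⟩ := hq
    exact ⟨p' + q', add_mem hp' hq', fun x => by rw [add_smul, add_smul, map_add, h, h']⟩
  | neg p _ hp =>
    obtain ⟨p', hp', h⟩ := hp
    exact ⟨-p', neg_mem hp', fun x => by rw [neg_smul, neg_smul, map_neg, h]⟩
  | mul p q _ _ hp hq =>
    obtain ⟨p', hp', h⟩ := hp
    obtain ⟨q', hq', h'⟩ := hq
    exact ⟨p' * q', mul_mem hp' hq', h.mul h'⟩

lemma Intertwines.map_mem_UAv (hφ : Intertwines G H φ) (hnd : n ≤ d) (hu : φ u ∈ UAv G v) {x : X}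
    (hx : x ∈ UAv H u) : φ x ∈ UAv G v := by
  obtain ⟨p, hp, rfl⟩ := hx
  obtain ⟨p', hp', h⟩ := hφ.exists_carries hnd hp
  obtain ⟨r, hr, hru⟩ := hu
  exact ⟨p' * r, mul_mem hp' hr, by rw [h, hru, mul_smul]⟩

end Integral

/-! ### Linear algebra over `A₀` -/

section Lattice

variable {W : Type} [AddCommGroup W] [Module KK W]

lemma algebraMap_mem_A0 (p : Polynomial ℚ) : algebraMap (Polynomial ℚ) KK p ∈ A0 := by
  change (RatFunc.denom _).eval 0 ≠ 0
  simp [RatFunc.denom_algebraMap]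

lemma algebraMap_rat_mem_A0 (r : ℚ) : algebraMap ℚ KK r ∈ A0 := by
  rw [IsScalarTower.algebraMap_apply ℚ (Polynomial ℚ) KK]
  exact algebraMap_mem_A0 _

lemma inv_qv_notMem_A0 : qv⁻¹ ∉ A0 := by
  intro h
  refine h ?_
  have h1 := RatFunc.num_div_denom (qv⁻¹)
  have h2 : algebraMap (Polynomial ℚ) KK (RatFunc.denom qv⁻¹) ≠ 0 :=
    RatFunc.algebraMap_ne_zero (RatFunc.denom_ne_zero _)
  rw [div_eq_iff h2, eq_inv_mul_iff_mul_eq₀ qv_ne_zero, qv, ← RatFunc.algebraMap_X, ← map_mul] at h1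
  have h3 := RatFunc.algebraMap_injective ℚ h1
  rw [RatFunc.algebraMap_X] at h3
  change (RatFunc.denom (RatFunc.X)⁻¹).eval 0 = 0
  rw [← h3]
  simp

instance isFractionRing_A0 : IsFractionRing A0 KK :=
  IsFractionRing.of_field _ _ fun z =>
    ⟨⟨_, algebraMap_mem_A0 z.num⟩, ⟨_, algebraMap_mem_A0 z.denom⟩, z.num_div_denom.symm⟩

lemma linearIndependent_of_A0 {ι : Type} {b : ι → W} (hb : LinearIndependent A0 b) :
    LinearIndependent KK b :=
  (LinearIndependent.iff_fractionRing A0 KK).1 hb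

lemma linearCombination_mapRange {R : Type} [CommRing R] [Module R W] [Algebra R KK]
    [IsScalarTower R KK W] {ι : Type} (b : ι → W) (c : ι →₀ R) :
    Finsupp.linearCombination KK b (c.mapRange (algebraMap R KK) (map_zero _)) =
      Finsupp.linearCombination R b c := by
  rw [Finsupp.linearCombination_apply, Finsupp.linearCombination_apply,
    Finsupp.sum_mapRange_index (by simp)]
  simp

lemma eq_zero_of_mem_span_rat [Module ℚ W] [IsScalarTower ℚ KK W] {S : Set W}
    (hS : LinearIndependent A0 (fun g : S => (g : W))) {y : W}
    (hy : y ∈ Submodule.span A0 S) (hqy : qv • y ∈ Submodule.span ℚ S) : qv • y = 0 := by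
  rw [← Subtype.range_coe (s := S), Finsupp.mem_span_range_iff_exists_finsupp] at hy hqy
  obtain ⟨a, ha⟩ := hy
  obtain ⟨c, hc⟩ := hqy
  rw [← Finsupp.linearCombination_apply, ← linearCombination_mapRange] at ha hc
  have h1 : Finsupp.linearCombination KK (fun g : S => (g : W))
      (c.mapRange (algebraMap ℚ KK) (map_zero _)) =
      Finsupp.linearCombination KK (fun g : S => (g : W))
        (qv • a.mapRange (algebraMap A0 KK) (map_zero _)) := by
    rw [hc, map_smul, ha]
  have h2 := linearIndependent_of_A0 hS h1
  have h3 : c = 0 := by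
    ext g
    by_contra h
    have h4 := DFunLike.congr_fun h2 g
    rw [Finsupp.mapRange_apply, Finsupp.smul_apply, Finsupp.mapRange_apply, smul_eq_mul] at h4
    have h5 : algebraMap ℚ KK (c g) ≠ 0 := by simpa using h
    have h6 : qv⁻¹ = algebraMap ℚ KK (c g)⁻¹ * (a g : KK) := by
      rw [map_inv₀, eq_inv_mul_iff_mul_eq₀ h5, h4, mul_comm, inv_mul_cancel_left₀ qv_ne_zero]
      rfl
    exact inv_qv_notMem_A0 (h6 ▸ mul_mem (algebraMap_rat_mem_A0 _) (a g).2)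
  rw [← hc, h3]
  simp

lemma eq_of_subset_of_span_eq_top {S T : Set W} (hS : LinearIndependent KK (fun g : S => (g : W)))
    (hTS : T ⊆ S) (hT : Submodule.span KK T = ⊤) : T = S := by
  refine hTS.antisymm fun g hg => ?_
  by_contra h
  have h1 := hS.notMem_span_image (s := {x | (x : W) ∈ T}) (x := ⟨g, hg⟩) h
  have h2 : (fun x : S => (x : W)) '' {x | (x : W) ∈ T} = T := by
    ext x
    exact ⟨fun ⟨y, hy, hyx⟩ => hyx ▸ hy, fun hx => ⟨⟨x, hTS hx⟩, hx, rfl⟩⟩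
  rw [h2, hT] at h1
  exact h1 Submodule.mem_top

end Lattice

section GlobalBasis

variable {n : ℕ} {G} {H : QGroup n}
  {W : Type} [AddCommGroup W] [Module ℚ W] [Module KK W] [Module G.U W] [IsScalarTower KK G.U W]
  [IsScalarTower ℚ KK W] {v : W} {psi : W →+ W} {Gs : Set W}
  {X : Type} [AddCommGroup X] [Module ℚ X] [Module KK X] [Module H.U X] [IsScalarTower KK H.U X]
  [IsScalarTower ℚ KK X] {u : X} {psihat : X →+ X} {Gh : Set X}
  {φ : X →ₗ[KK] W}

namespace IsLowerGlobalBasis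

omit [IsScalarTower KK G.U W] [IsScalarTower ℚ KK W] in
lemma linearIndependent (h : IsLowerGlobalBasis G v psi Gs) :
    LinearIndependent KK (fun g : Gs => (g : W)) :=
  linearIndependent_of_A0 h.2.1

omit [IsScalarTower KK G.U W] [IsScalarTower ℚ KK W] in
lemma ne_zero (h : IsLowerGlobalBasis G v psi Gs) {g : W} (hg : g ∈ Gs) : g ≠ 0 :=
  h.linearIndependent.ne_zero ⟨g, hg⟩

omit [IsScalarTower KK G.U W] in
lemma eq_zero_of_mem_qLmod (h : IsLowerGlobalBasis G v psi Gs) {x : W}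
    (hx : x ∈ Submodule.span ℚ Gs) (hx' : x ∈ qLmod G v) : x = 0 := by
  obtain ⟨y, hy, rfl⟩ := hx'
  rw [← h.1] at hy
  exact eq_zero_of_mem_span_rat h.2.1 hy hx

omit [IsScalarTower KK G.U W] in
lemma notMem_qLmod (h : IsLowerGlobalBasis G v psi Gs) {g : W} (hg : g ∈ Gs) : g ∉ qLmod G v :=
  fun hg' => h.ne_zero hg (h.eq_zero_of_mem_qLmod (Submodule.subset_span hg) hg')

omit [IsScalarTower KK G.U W] [IsScalarTower ℚ KK W] in
lemma latticeGens_subset_span (h : IsLowerGlobalBasis G v psi Gs) :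
    latticeGens G v ⊆ Submodule.span KK Gs := fun x hx => by
  have h1 : x ∈ Submodule.span A0 Gs := by
    rw [h.1]
    exact Submodule.subset_span hx
  exact Submodule.span_le_restrictScalars A0 KK Gs h1

omit [IsScalarTower KK G.U W] [IsScalarTower KK H.U X] [IsScalarTower ℚ KK X] in
/-- An embedding compatible with the integral forms, crystals and bar involutions maps lower
global basis elements to lower global basis elements. -/
lemma map_mem (h : IsLowerGlobalBasis G v psi Gs) (h' : IsLowerGlobalBasis H u psihat Gh)
    (hinj : Function.Injective φ) (hUA : ∀ x ∈ UAv H u, φ x ∈ UAv G v)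
    (hlat : ∀ x ∈ latticeGens H u, φ x ∈ latticeGens G v)
    (hpsi : ∀ x, psi (φ x) = φ (psihat x)) {g : X} (hg : g ∈ Gh) : φ g ∈ Gs := by
  obtain ⟨-, -, i3, -, i5, -, -, -, i9⟩ := id h
  obtain ⟨-, -, j3, -, -, j6, j7, -, -⟩ := id h'
  have hL : φ g ∈ Llat G v := map_Llat_le hlat ⟨g, (j3 hg).1.2, rfl⟩
  have h1 : φ g ∈ Submodule.span ℚ Gs :=
    i5 _ ⟨⟨hUA _ (j3 hg).1.1, hL⟩, φ g, hL, by rw [hpsi, j6 g hg]⟩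
  obtain ⟨y, hy, -, hgy⟩ := j7 g hg
  have h2 : φ g - φ y ∈ qLmod G v := by
    rw [← map_sub]
    exact map_mem_qLmod hlat hgy
  have h3 : φ y ∉ qLmod G v := by
    intro hy'
    have h4 := h.eq_zero_of_mem_qLmod h1 ((Submodule.sub_mem_iff_left _ hy').1 h2)
    exact h'.ne_zero hg (hinj (h4.trans (map_zero φ).symm))
  obtain ⟨g', hg', h5⟩ := i9 _ (hlat y hy) h3
  have h6 : φ g - g' ∈ qLmod G v := by
    have := sub_mem h2 h5
    rwa [sub_sub_sub_cancel_right] at this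
  have h7 := h.eq_zero_of_mem_qLmod (sub_mem h1 (Submodule.subset_span hg')) h6
  rwa [sub_eq_zero.1 h7]

omit [IsScalarTower KK G.U W] [IsScalarTower KK H.U X] [IsScalarTower ℚ KK X] in
/-- Under such an embedding, an element of the crystal not in `qL` is not mapped into `qL`. -/
lemma map_notMem_qLmod (h : IsLowerGlobalBasis G v psi Gs) (h' : IsLowerGlobalBasis H u psihat Gh)
    (hlat : ∀ x ∈ latticeGens H u, φ x ∈ latticeGens G v) (hmem : ∀ g ∈ Gh, φ g ∈ Gs) {y : X}
    (hy : y ∈ latticeGens H u) (hy' : y ∉ qLmod H u) : φ y ∉ qLmod G v := by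
  obtain ⟨g, hg, hgy⟩ := h'.2.2.2.2.2.2.2.2 y hy hy'
  intro h1
  have h2 := map_mem_qLmod hlat hgy
  rw [map_sub, Submodule.sub_mem_iff_left _ h1] at h2
  exact h.notMem_qLmod (hmem g hg) h2

end IsLowerGlobalBasis

end GlobalBasis

/-- Theorem `res`:  for `λ = m ω_a`, the crystal lattice,
crystal basis and lower global basis of `V^λ` are the (disjoint) unions of
the images under the `U_q(sl_{k-1})`-module isomorphisms
`φ_j : V̂^{λ^j} ≅ U_q(sl_{k-1}) v_j ⊆ V^λ` of the crystal lattices, crystal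
bases, and lower global bases of the `V̂^{λ^j}`:
(1) `L^λ = ⊕_{j=0}^m φ_j(L̂^{λ^j})`;
(2) `B^λ = ⊔_{j=0}^m φ_j(B̂^{λ^j})` (stated modulo `qL`, elements of the
crystal bases being represented by elements of the Kashiwara orbits of the
highest weight vectors not lying in `qL`);
(3) `G^λ = ⊔_{j=0}^m φ_j(Ĝ^{λ^j})`; in particular `φ_j(Ĝ^j_b) = G_{φ_j(b)}`
for all `b ∈ B̂^{λ^j}`. -/
theorem lower_global_basis_restriction
    (k a m : ℕ) (hk : 3 ≤ k) (ha : 1 ≤ a) (hak : a ≤ k - 1) (hm : 1 ≤ m)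
    (G : QGroup (k - 1)) (V : Type) [AddCommGroup V] [Module ℚ V] [Module KK V]
    [Module G.U V] [IsScalarTower KK G.U V] [IsScalarTower ℚ KK V]
    (v : V) (hV : IsHWModule G (omWt a m) v)
    (barK : KK →+* KK) (hbar : IsBarK barK)
    (psi : V →+ V) (hpsi : IsPsi G v barK psi)
    (Gs : Set V) (hGs : IsLowerGlobalBasis G v psi Gs)
    (H : QGroup (k - 2))
    (Vhat : Fin (m + 1) → Type) [∀ j, AddCommGroup (Vhat j)]
    [∀ j, Module ℚ (Vhat j)] [∀ j, Module KK (Vhat j)] [∀ j, Module H.U (Vhat j)]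
    [∀ j, IsScalarTower KK H.U (Vhat j)] [∀ j, IsScalarTower ℚ KK (Vhat j)]
    (u : (j : Fin (m + 1)) → Vhat j)
    (hu : ∀ j : Fin (m + 1), IsHWModule H (hookWt a m j.1) (u j))
    (psihat : (j : Fin (m + 1)) → (Vhat j →+ Vhat j))
    (hpsihat : ∀ j, IsPsi H (u j) barK (psihat j))
    (Ghat : (j : Fin (m + 1)) → Set (Vhat j))
    (hGhat : ∀ j, IsLowerGlobalBasis H (u j) (psihat j) (Ghat j))
    (φ : (j : Fin (m + 1)) → (Vhat j →ₗ[KK] V))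
    (hφu : ∀ j : Fin (m + 1), φ j (u j) = fDivChain G (fun _ => j.1) a (k - 1) v)
    (hφe : ∀ (j : Fin (m + 1)) i, 1 ≤ i → i ≤ k - 2 → ∀ x : Vhat j,
        φ j (H.e i • x) = G.e i • φ j x)
    (hφf : ∀ (j : Fin (m + 1)) i, 1 ≤ i → i ≤ k - 2 → ∀ x : Vhat j,
        φ j (H.f i • x) = G.f i • φ j x)
    (hφK : ∀ (j : Fin (m + 1)) i, 1 ≤ i → i ≤ k - 2 → ∀ x : Vhat j,
        φ j (H.K i • x) = G.K i • φ j x)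
    (hφKinv : ∀ (j : Fin (m + 1)) i, 1 ≤ i → i ≤ k - 2 → ∀ x : Vhat j,
        φ j (H.Kinv i • x) = G.Kinv i • φ j x)
    (hφinj : ∀ j : Fin (m + 1), Function.Injective (φ j))
    (hφrange : ∀ j : Fin (m + 1), LinearMap.range (φ j) =
        USpan G (k - 2) (fDivChain G (fun _ => j.1) a (k - 1) v))
 :
    -- (1)  `L^λ = ⊕_{j=0}^m φ_j(L̂^{λ^j})`
    ((⨆ j : Fin (m + 1), Submodule.map (toA0Linear (φ j)) (Llat H (u j)))
        = Llat G v ∧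
      (∀ j : Fin (m + 1),
        Disjoint (Submodule.map (toA0Linear (φ j)) (Llat H (u j)))
          (⨆ j' : Fin (m + 1), ⨆ _ : j' ≠ j,
            Submodule.map (toA0Linear (φ j')) (Llat H (u j'))))) ∧
    -- (2)  `B^λ = ⊔_{j=0}^m φ_j(B̂^{λ^j})` in `L/qL`
    ((∀ x ∈ latticeGens G v, x ∉ qLmod G v →
        ∃! j : Fin (m + 1), ∃ y ∈ latticeGens H (u j),
          y ∉ qLmod H (u j) ∧ x - φ j y ∈ qLmod G v) ∧
      (∀ j : Fin (m + 1), ∀ y ∈ latticeGens H (u j), y ∉ qLmod H (u j) →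
        φ j y ∉ qLmod G v ∧ ∃ x ∈ latticeGens G v, x - φ j y ∈ qLmod G v)) ∧
    -- (3)  `G^λ = ⊔_{j=0}^m φ_j(Ĝ^{λ^j})`
    (Gs = (⋃ j : Fin (m + 1), φ j '' Ghat j) ∧
      (∀ j j' : Fin (m + 1), j ≠ j' →
        Disjoint (φ j '' Ghat j) (φ j' '' Ghat j')) ∧
      (∀ j : Fin (m + 1), ∀ g ∈ Ghat j, φ j g ∈ Gs)) := by
  have hd : k - 2 < k - 1 := by omega
  have hv := hV.wt
  have hw := hV.hw
  have := hV.findim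
  have hφ : ∀ j, Intertwines G H (φ j) := fun j => ⟨hφe j, hφf j, hφK j, hφKinv j⟩
  have hchain : a - 1 ≤ k - 1 := by omega
  have hmem : ∀ j : Fin (m + 1), φ j (u j) ∈ fSpace G v _ := fun j =>
    (hφu j).symm ▸ fDivChain_mem_fSpace G ha j.1 hchain le_rfl
  have hgen : ∀ j : Fin (m + 1), φ j (u j) ∈ latticeGens G v := fun j =>
    (hφu j).symm ▸ fDivChain_mem_latticeGens G hv hw ha j.1 hchain le_rfl
  have hUA : ∀ j : Fin (m + 1), φ j (u j) ∈ UAv G v := fun j =>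
    (hφu j).symm ▸ fDivChain_mem_UAv G ha j.1 hchain le_rfl
  have hfix : ∀ j : Fin (m + 1), psi (φ j (u j)) = φ j (u j) := fun j =>
    (hφu j).symm ▸ psi_fDivChain G hbar hpsi ha j.1 hchain le_rfl
  have hlat : ∀ j, ∀ x ∈ latticeGens H (u j), φ j x ∈ latticeGens G v := fun j x hx =>
    (hφ j).map_mem_latticeGens hd.le hv hw (hu j) (hmem j) (hgen j) hx
  have hglob : ∀ j, ∀ g ∈ Ghat j, φ j g ∈ Gs := fun j g hg =>
    hGs.map_mem (hGhat j) (hφinj j) (fun x hx => (hφ j).map_mem_UAv hd.le (hUA j) hx) (hlat j)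
      (fun x => (hφ j).map_psi hd.le (hu j) hpsi (hpsihat j) (hfix j) x) hg
  have hind : iSupIndep fun j => LinearMap.range (φ j) :=
    iSupIndep_of_le_fSpace G (by omega) hv _ (fun j : Fin (m + 1) => (j.1 : ℤ))
      (fun i j hij => Fin.ext (Int.ofNat_inj.1 hij)) fun j =>
        ((hφ j).range_le_iSup_fSpace hd (hu j) (hmem j)).trans <| iSup_le fun c =>
          le_iSup (fun c : {c : ℕ → ℤ // c (k - 1) = j.1} => fSpace G v c.1)
            ⟨c.1, c.2.trans (if_pos ⟨hak, le_rfl⟩)⟩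
  have hunion : (⋃ j, φ j '' Ghat j) = Gs := by
    refine eq_of_subset_of_span_eq_top hGs.linearIndependent
      (Set.iUnion_subset fun j => Set.image_subset_iff.2 (hglob j)) (top_unique ?_)
    rw [← iSup_USpan_eq_top G hV ha hak, Nat.sub_sub]
    refine iSup_le fun j => ?_
    rw [← hφrange j, LinearMap.range_eq_map, ← span_latticeGens_eq_top H (hu j),
      Submodule.map_span, Submodule.span_le]
    rintro _ ⟨x, hx, rfl⟩
    have h1 := Submodule.mem_map_of_mem (f := φ j) ((hGhat j).latticeGens_subset_span hx)
    rw [Submodule.map_span] at h1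
    exact Submodule.span_mono (Set.subset_iUnion (fun j => φ j '' Ghat j) j) h1
  have hsep : ∀ j j', ∀ g ∈ Ghat j, ∀ g' ∈ Ghat j', φ j g = φ j' g' → j = j' := by
    intro j j' g hg g' _ h
    by_contra hne
    exact hGs.ne_zero (hglob j g hg) (Submodule.disjoint_def.1 (hind.pairwiseDisjoint hne) _
      (LinearMap.mem_range_self _ g) (h ▸ LinearMap.mem_range_self _ g'))
  refine ⟨⟨le_antisymm (iSup_le fun j => map_Llat_le (hlat j)) ?_, fun j => ?_⟩,
    ⟨fun x hx hx' => ?_, fun j y hy hy' => ?_⟩, hunion.symm, fun j j' hne => ?_, hglob⟩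
  · rw [← hGs.1, Submodule.span_le, ← hunion]
    refine Set.iUnion_subset fun j => ?_
    rintro _ ⟨g, hg, rfl⟩
    exact Submodule.mem_iSup_of_mem j ⟨g, ((hGhat j).2.2.1 hg).1.2, rfl⟩
  · rw [Submodule.disjoint_def]
    rintro _ ⟨x, -, rfl⟩ hx
    have hle : (⨆ j' : Fin (m + 1), ⨆ _ : j' ≠ j,
        Submodule.map (toA0Linear (φ j')) (Llat H (u j'))) ≤
        (⨆ j' : Fin (m + 1), ⨆ _ : j' ≠ j, LinearMap.range (φ j')).restrictScalars A0 := by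
      refine iSup₂_le fun j' hj' => ?_
      rintro _ ⟨y, -, rfl⟩
      exact Submodule.mem_iSup_of_mem j'
        (Submodule.mem_iSup_of_mem hj' (LinearMap.mem_range_self (φ j') y))
    exact Submodule.disjoint_def.1 (hind j) _ (LinearMap.mem_range_self (φ j) x) (hle hx)
  · obtain ⟨g₀, hg₀, h₀⟩ := hGs.2.2.2.2.2.2.2.2 x hx hx'
    obtain ⟨j, g, hg, rfl⟩ := Set.mem_iUnion.1 (hunion.symm ▸ hg₀)
    obtain ⟨y, hy, hy', hgy⟩ := (hGhat j).2.2.2.2.2.2.1 g hg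
    have h1 := sub_mem (map_mem_qLmod (hlat j) hgy) h₀
    rw [map_sub, sub_sub_sub_cancel_left] at h1
    refine ⟨j, ⟨y, hy, hy', h1⟩, ?_⟩
    rintro j' ⟨z, hz, hz', h2⟩
    obtain ⟨g', hg', h3⟩ := (hGhat j').2.2.2.2.2.2.2.2 z hz hz'
    have h4 := sub_mem (sub_mem (map_mem_qLmod (hlat j') h3) h2) h₀
    have h5 : φ j' (g' - z) - (x - φ j' z) - (φ j g - x) = φ j' g' - φ j g := by
      rw [map_sub]
      abel
    rw [h5] at h4
    exact hsep _ _ g' hg' g hg (hGs.2.2.2.2.2.2.2.1 _ (hglob j' g' hg') _ hg₀ h4)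
  · exact ⟨hGs.map_notMem_qLmod (hGhat j) (hlat j) (hglob j) hy hy', φ j y, hlat j y hy,
      by rw [sub_self]; exact zero_mem _⟩
  · rw [Set.disjoint_left]
    rintro _ ⟨g, hg, rfl⟩ ⟨g', hg', h⟩
    exact hne (hsep _ _ g hg g' hg' h.symm)

end QSL
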